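/- arXiv:1102.3860 — 5 statements merged into one kernel-verified Lean document; each statement's English description precedes it below -/
import Mathlib

section
/- Let X be a separable Banach space, γ a centered Gaussian measure on X, and C ⊆ X a convex Borel set. Then for all t₁, t₂ > 0 and all λ ∈ [0,1] one has γ((λt₁ + (1−λ)t₂)C) ≥ γ(t₁C)^λ · γ(t₂C)^{1−λ}; equivalently, the extended-real-valued function t ↦ log γ(tC) is concave on (0,∞). -/
open MeasureTheory ProbabilityTheory
open scoped Pointwise ENNReal NNReal

section PrekopaLeindler

theorem MeasurableSet.measure_eq_iSup_isCompact_subtype {α : Type*} [TopologicalSpace α]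
    [MeasurableSpace α] {A : Set α} (hA : MeasurableSet A) (μ : Measure α) [μ.InnerRegular] :
    μ A = ⨆ K : {K : Set α // K ⊆ A ∧ IsCompact K}, μ K := by
  rw [hA.measure_eq_iSup_isCompact, iSup_subtype]
  simp only [iSup_and]

instance nonempty_compact_subset {α : Type*} [TopologicalSpace α] (A : Set α) :
    Nonempty {K : Set α // K ⊆ A ∧ IsCompact K} :=
  ⟨⟨∅, Set.empty_subset A, isCompact_empty⟩⟩

/-- The one-dimensional Brunn–Minkowski inequality. -/
theorem Real.volume_add_volume_le_of_add_subset {A B S : Set ℝ} (hA : MeasurableSet A)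
    (hB : MeasurableSet B) (hA₀ : A.Nonempty) (hB₀ : B.Nonempty) (hS : A + B ⊆ S) :
    volume A + volume B ≤ volume S := by
  have compact_case : ∀ K L : Set ℝ, IsCompact K → IsCompact L → K.Nonempty → L.Nonempty →
      K ⊆ A → L ⊆ B → volume K + volume L ≤ volume S := by
    intro K L hK hL hK₀ hL₀ hKA hLB
    obtain ⟨a, haK, ha⟩ := hK.exists_isGreatest hK₀
    obtain ⟨b, hbL, hb⟩ := hL.exists_isLeast hL₀
    have hdisj : AEDisjoint volume ((fun x ↦ x + b) '' K) ((fun y ↦ a + y) '' L) := by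
      refine measure_mono_null (t := {a + b}) ?_ (by simp)
      rintro _ ⟨⟨x, hx, rfl⟩, y, hy, hxy⟩
      have := ha hx
      have := hb hy
      simp only [Set.mem_singleton_iff] at *
      linarith
    calc volume K + volume L
        = volume ((fun x ↦ x + b) '' K) + volume ((fun y ↦ a + y) '' L) := by
          simp [Set.image_add_right, Set.image_add_left, measure_preimage_add,
            measure_preimage_add_right]
      _ = volume (((fun x ↦ x + b) '' K) ∪ ((fun y ↦ a + y) '' L)) := by
          rw [measure_union₀ _ hdisj]
          exact (hL.image (by fun_prop)).measurableSet.nullMeasurableSet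
      _ ≤ volume S := by
          refine measure_mono (Set.union_subset ?_ ?_)
          · rintro _ ⟨x, hx, rfl⟩
            exact hS (Set.add_mem_add (hKA hx) (hLB hbL))
          · rintro _ ⟨y, hy, rfl⟩
            exact hS (Set.add_mem_add (hKA haK) (hLB hy))
  obtain ⟨a, ha⟩ := hA₀
  obtain ⟨b, hb⟩ := hB₀
  rw [hA.measure_eq_iSup_isCompact_subtype volume, hB.measure_eq_iSup_isCompact_subtype volume]
  simp only [ENNReal.iSup_add, ENNReal.add_iSup, iSup_le_iff, Subtype.forall]
  rintro L ⟨hLB, hL⟩ K ⟨hKA, hK⟩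
  calc volume K + volume L ≤ volume (insert a K) + volume (insert b L) := by
        gcongr <;> exact Set.subset_insert _ _
    _ ≤ volume S := compact_case _ _ (hK.insert a) (hL.insert b) (Set.insert_nonempty _ _)
        (Set.insert_nonempty _ _) (Set.insert_subset ha hKA) (Set.insert_subset hb hLB)

theorem MeasureTheory.lintegral_eq_lintegral_meas_ofReal_lt {α : Type*} [MeasurableSpace α]
    (μ : Measure α) {f : α → ℝ≥0∞} (hf : Measurable f) (hf_top : ∀ x, f x ≠ ∞) :
    ∫⁻ x, f x ∂μ = ∫⁻ t in Set.Ioi (0 : ℝ), μ {x | ENNReal.ofReal t < f x} := by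
  have h := lintegral_eq_lintegral_meas_lt μ (f := fun x ↦ (f x).toReal)
    (.of_forall fun x ↦ ENNReal.toReal_nonneg) hf.ennreal_toReal.aemeasurable
  simp only [ENNReal.ofReal_toReal (hf_top _)] at h
  rw [h]
  refine setLIntegral_congr_fun measurableSet_Ioi fun t ht ↦ ?_
  simp only [ENNReal.ofReal_lt_iff_lt_toReal (le_of_lt ht) (hf_top _)]

theorem ENNReal.geom_mean_le_arith_mean2 {w : ℝ} (hw₀ : 0 < w) (hw₁ : w < 1) (a b : ℝ≥0∞) :
    a ^ w * b ^ (1 - w) ≤ ENNReal.ofReal w * a + ENNReal.ofReal (1 - w) * b := by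
  have hw₁' : 0 < 1 - w := sub_pos.2 hw₁
  rcases eq_or_ne a ∞ with rfl | ha
  · rw [ENNReal.mul_top (by simpa using hw₀), top_add]; exact le_top
  rcases eq_or_ne b ∞ with rfl | hb
  · rw [ENNReal.mul_top (by simpa using hw₁), add_top]; exact le_top
  lift a to ℝ≥0 using ha
  lift b to ℝ≥0 using hb
  rw [← ENNReal.coe_rpow_of_nonneg _ hw₀.le, ← ENNReal.coe_rpow_of_nonneg _ hw₁'.le]
  have h := NNReal.geom_mean_le_arith_mean2_weighted w.toNNReal (1 - w).toNNReal a b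
    (by rw [← Real.toNNReal_add hw₀.le hw₁'.le]; simp)
  simp only [Real.coe_toNNReal _ hw₀.le, Real.coe_toNNReal _ hw₁'.le] at h
  rw [ENNReal.ofReal, ENNReal.ofReal]
  exact_mod_cast h

/-- The one-dimensional Prékopa–Leindler inequality for functions with supremum one. -/
theorem prekopa_leindler_real_of_iSup_eq_one {w : ℝ} (hw₀ : 0 < w) (hw₁ : w < 1)
    {f g h : ℝ → ℝ≥0∞} (hf : Measurable f) (hg : Measurable g) (hh : Measurable h)
    (hf_sup : ⨆ x, f x = 1) (hg_sup : ⨆ x, g x = 1)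
    (hfgh : ∀ x y, f x ^ w * g y ^ (1 - w) ≤ h (w • x + (1 - w) • y)) :
    (∫⁻ x, f x) ^ w * (∫⁻ x, g x) ^ (1 - w) ≤ ∫⁻ x, h x := by
  have hw₁' : 0 < 1 - w := sub_pos.2 hw₁
  have hf_le : ∀ x, f x ≤ 1 := fun x ↦ hf_sup ▸ le_iSup f x
  have hg_le : ∀ x, g x ≤ 1 := fun x ↦ hg_sup ▸ le_iSup g x
  have level : ∀ t : ℝ, 0 < t →
      ENNReal.ofReal w * volume {x | ENNReal.ofReal t < f x} +
        ENNReal.ofReal (1 - w) * volume {x | ENNReal.ofReal t < g x} ≤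
      volume {x | ENNReal.ofReal t < min (h x) 1} := by
    intro t ht
    rcases le_or_gt 1 t with ht₁ | ht₁
    · have ht₁' : 1 ≤ ENNReal.ofReal t := by simpa using ht₁
      have hf_empty : {x | ENNReal.ofReal t < f x} = ∅ :=
        Set.eq_empty_of_forall_notMem fun x hx ↦ ((hf_le x).trans ht₁').not_gt hx
      have hg_empty : {x | ENNReal.ofReal t < g x} = ∅ :=
        Set.eq_empty_of_forall_notMem fun x hx ↦ ((hg_le x).trans ht₁').not_gt hx
      simp [hf_empty, hg_empty]
    · have ht₁' : ENNReal.ofReal t < 1 := by simpa using ht₁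
      have ht₀ : ENNReal.ofReal t ≠ 0 := by simpa using ht
      have hf_ne : {x | ENNReal.ofReal t < f x}.Nonempty :=
        lt_iSup_iff.1 (ht₁'.trans_eq hf_sup.symm)
      have hg_ne : {x | ENNReal.ofReal t < g x}.Nonempty :=
        lt_iSup_iff.1 (ht₁'.trans_eq hg_sup.symm)
      have key := Real.volume_add_volume_le_of_add_subset
        (A := w • {x | ENNReal.ofReal t < f x}) (B := (1 - w) • {x | ENNReal.ofReal t < g x})
        (S := {x | ENNReal.ofReal t < min (h x) 1})
        ((measurableSet_lt measurable_const hf).const_smul₀ w)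
        ((measurableSet_lt measurable_const hg).const_smul₀ (1 - w))
        (Set.Nonempty.smul_set hf_ne)
        (Set.Nonempty.smul_set hg_ne) ?_
      · simpa [Measure.addHaar_smul, abs_of_pos hw₀, abs_of_pos hw₁'] using key
      · rintro _ ⟨_, ⟨x, hx, rfl⟩, _, ⟨y, hy, rfl⟩, rfl⟩
        refine lt_min (lt_of_lt_of_le ?_ (hfgh x y)) ht₁'
        calc ENNReal.ofReal t = ENNReal.ofReal t ^ w * ENNReal.ofReal t ^ (1 - w) := by
              rw [← ENNReal.rpow_add _ _ ht₀ ENNReal.ofReal_ne_top]; simp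
          _ < f x ^ w * g y ^ (1 - w) :=
              ENNReal.mul_lt_mul (ENNReal.rpow_lt_rpow hx hw₀) (ENNReal.rpow_lt_rpow hy hw₁')
  have hmeas : ∀ k : ℝ → ℝ≥0∞, Measurable fun t : ℝ ↦ volume {x | ENNReal.ofReal t < k x} :=
    fun k ↦ Antitone.measurable fun s t hst ↦
      measure_mono fun x hx ↦ (ENNReal.ofReal_le_ofReal hst).trans_lt hx
  refine (ENNReal.geom_mean_le_arith_mean2 hw₀ hw₁ _ _).trans ?_
  refine le_trans ?_ (lintegral_mono fun x ↦ min_le_left (h x) 1)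
  rw [lintegral_eq_lintegral_meas_ofReal_lt _ hf fun x ↦ ((hf_le x).trans_lt ENNReal.one_lt_top).ne,
    lintegral_eq_lintegral_meas_ofReal_lt _ hg fun x ↦ ((hg_le x).trans_lt ENNReal.one_lt_top).ne,
    lintegral_eq_lintegral_meas_ofReal_lt _ (hh.min measurable_const) fun x ↦
      ((min_le_right _ _).trans_lt ENNReal.one_lt_top).ne,
    ← lintegral_const_mul _ (hmeas f), ← lintegral_const_mul _ (hmeas g),
    ← lintegral_add_left ((hmeas f).const_mul _)]
  exact setLIntegral_mono' measurableSet_Ioi level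

/-- The one-dimensional Prékopa–Leindler inequality for bounded functions. -/
theorem prekopa_leindler_real {w : ℝ} (hw₀ : 0 < w) (hw₁ : w < 1)
    {f g h : ℝ → ℝ≥0∞} (hf : Measurable f) (hg : Measurable g) (hh : Measurable h)
    (hf_sup : ⨆ x, f x ≠ ∞) (hg_sup : ⨆ x, g x ≠ ∞)
    (hfgh : ∀ x y, f x ^ w * g y ^ (1 - w) ≤ h (w • x + (1 - w) • y)) :
    (∫⁻ x, f x) ^ w * (∫⁻ x, g x) ^ (1 - w) ≤ ∫⁻ x, h x := by
  have hw₁' : 0 < 1 - w := sub_pos.2 hw₁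
  set a := ⨆ x, f x with ha
  set b := ⨆ x, g x with hb
  rcases eq_or_ne a 0 with ha₀ | ha₀
  · have : f = 0 := funext (ENNReal.iSup_eq_zero.1 ha₀)
    simp [this, hw₀]
  rcases eq_or_ne b 0 with hb₀ | hb₀
  · have : g = 0 := funext (ENNReal.iSup_eq_zero.1 hb₀)
    simp [this, hw₁]
  have key := prekopa_leindler_real_of_iSup_eq_one hw₀ hw₁ (hf.const_mul a⁻¹) (hg.const_mul b⁻¹)
    (hh.const_mul ((a ^ w)⁻¹ * (b ^ (1 - w))⁻¹))
    (by rw [← ENNReal.mul_iSup, ENNReal.inv_mul_cancel ha₀ hf_sup])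
    (by rw [← ENNReal.mul_iSup, ENNReal.inv_mul_cancel hb₀ hg_sup])
    (fun x y ↦ by
      rw [ENNReal.mul_rpow_of_nonneg _ _ hw₀.le, ENNReal.mul_rpow_of_nonneg _ _ hw₁'.le,
        ENNReal.inv_rpow, ENNReal.inv_rpow, mul_mul_mul_comm]
      gcongr
      exact hfgh x y)
  rw [lintegral_const_mul _ hf, lintegral_const_mul _ hg, lintegral_const_mul _ hh,
    ENNReal.mul_rpow_of_nonneg _ _ hw₀.le, ENNReal.mul_rpow_of_nonneg _ _ hw₁'.le,
    ENNReal.inv_rpow, ENNReal.inv_rpow, mul_mul_mul_comm] at key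
  refine (ENNReal.mul_le_mul_iff_right ?_ ?_).1 key
  · simp [hf_sup, hg_sup, hw₀.le, hw₁.le]
  · simp [ENNReal.mul_eq_top, ha₀, hb₀, hf_sup, hg_sup]

end PrekopaLeindler

section Measures

variable {E F : Type*} [AddCommGroup E] [Module ℝ E] [MeasurableSpace E]
  [AddCommGroup F] [Module ℝ F] [MeasurableSpace F]

/-- The measure `μ` satisfies the Prékopa–Leindler inequality with weights `w` and `1 - w`, for
functions bounded by one. -/
def SatisfiesPrekopaLeindler (μ : Measure E) (w : ℝ) : Prop :=
  ∀ f g h : E → ℝ≥0∞, Measurable f → Measurable g → Measurable h →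
    (∀ x, f x ≤ 1) → (∀ x, g x ≤ 1) →
    (∀ x y, f x ^ w * g y ^ (1 - w) ≤ h (w • x + (1 - w) • y)) →
    (∫⁻ x, f x ∂μ) ^ w * (∫⁻ x, g x ∂μ) ^ (1 - w) ≤ ∫⁻ x, h x ∂μ

namespace SatisfiesPrekopaLeindler

variable {μ : Measure E} {ν : Measure F} {w : ℝ}

theorem map (hμ : SatisfiesPrekopaLeindler μ w) {T : E → F} (hT : Measurable T)
    (hT_affine : ∀ x y, T (w • x + (1 - w) • y) = w • T x + (1 - w) • T y) :
    SatisfiesPrekopaLeindler (μ.map T) w := by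
  intro f g h hf hg hh hf_le hg_le hfgh
  rw [lintegral_map hf hT, lintegral_map hg hT, lintegral_map hh hT]
  refine hμ _ _ _ (hf.comp hT) (hg.comp hT) (hh.comp hT) (fun x ↦ hf_le _) (fun x ↦ hg_le _)
    fun x y ↦ ?_
  rw [hT_affine]
  exact hfgh _ _

theorem prod [SFinite μ] [IsProbabilityMeasure ν] (hμ : SatisfiesPrekopaLeindler μ w)
    (hν : SatisfiesPrekopaLeindler ν w) : SatisfiesPrekopaLeindler (μ.prod ν) w := by
  have marginal_le : ∀ k : E × F → ℝ≥0∞, (∀ z, k z ≤ 1) → ∀ x, ∫⁻ y, k (x, y) ∂ν ≤ 1 :=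
    fun k hk x ↦ (lintegral_mono fun y ↦ hk (x, y)).trans_eq (by simp)
  intro f g h hf hg hh hf_le hg_le hfgh
  rw [lintegral_prod _ hf.aemeasurable, lintegral_prod _ hg.aemeasurable,
    lintegral_prod _ hh.aemeasurable]
  refine hμ _ _ _ hf.lintegral_prod_right' hg.lintegral_prod_right' hh.lintegral_prod_right'
    (marginal_le f hf_le) (marginal_le g hg_le) fun x x' ↦ ?_
  exact hν _ _ _ (hf.comp measurable_prodMk_left) (hg.comp measurable_prodMk_left)
    (hh.comp measurable_prodMk_left) (fun y ↦ hf_le _) (fun y ↦ hg_le _)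
    fun y y' ↦ hfgh (x, y) (x', y')

theorem dirac (a : E) : SatisfiesPrekopaLeindler (Measure.dirac a) w := by
  intro f g h hf hg hh _ _ hfgh
  rw [lintegral_dirac' _ hf, lintegral_dirac' _ hg, lintegral_dirac' _ hh]
  refine (hfgh a a).trans_eq ?_
  rw [← add_smul, add_sub_cancel, one_smul]

theorem pi : ∀ {n : ℕ} {μ : Fin n → Measure ℝ} [∀ i, IsProbabilityMeasure (μ i)],
    (∀ i, SatisfiesPrekopaLeindler (μ i) w) → SatisfiesPrekopaLeindler (Measure.pi μ) w
  | 0, μ, _, _ => by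
    rw [Measure.pi_of_empty μ 0]
    exact dirac _
  | n + 1, μ, _, hμ => by
    rw [← (measurePreserving_piFinSuccAbove μ 0).symm.map_eq]
    refine ((hμ 0).prod (pi fun i ↦ hμ _)).map (MeasurableEquiv.measurable _) fun x y ↦ ?_
    ext i
    refine Fin.cases ?_ (fun j ↦ ?_) i <;> simp [MeasurableEquiv.piFinSuccAbove]

theorem measure_rpow_mul_le (hμ : SatisfiesPrekopaLeindler μ w) (hw₀ : 0 < w) (hw₁ : w < 1)
    {A B S : Set E} (hA : MeasurableSet A) (hB : MeasurableSet B) (hS : MeasurableSet S)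
    (hABS : ∀ x ∈ A, ∀ y ∈ B, w • x + (1 - w) • y ∈ S) :
    μ A ^ w * μ B ^ (1 - w) ≤ μ S := by
  have key := hμ (A.indicator 1) (B.indicator 1) (S.indicator 1) (measurable_one.indicator hA)
    (measurable_one.indicator hB) (measurable_one.indicator hS)
    (Set.indicator_le_self' (by simp)) (Set.indicator_le_self' (by simp)) fun x y ↦ ?_
  · simpa [lintegral_indicator_one, hA, hB, hS] using key
  · by_cases hx : x ∈ A
    · by_cases hy : y ∈ B
      · simp [hx, hy, hABS x hx y hy]
      · simp [hy, hw₁]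
    · simp [hx, hw₀]

theorem gaussianReal_zero_one (hw₀ : 0 < w) (hw₁ : w < 1) :
    SatisfiesPrekopaLeindler (gaussianReal 0 1) w := by
  have hw₁' : 0 < 1 - w := sub_pos.2 hw₁
  have hφ := measurable_gaussianPDF 0 1
  have hφ_logConcave : ∀ x y : ℝ, gaussianPDF 0 1 x ^ w * gaussianPDF 0 1 y ^ (1 - w) ≤
      gaussianPDF 0 1 (w • x + (1 - w) • y) := by
    intro x y
    have hpos := gaussianPDFReal_pos 0 1
    simp only [gaussianPDF]
    rw [ENNReal.ofReal_rpow_of_pos (hpos x one_ne_zero),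
      ENNReal.ofReal_rpow_of_pos (hpos y one_ne_zero),
      ← ENNReal.ofReal_mul (Real.rpow_nonneg (hpos x one_ne_zero).le _)]
    refine ENNReal.ofReal_le_ofReal ?_
    have hc : 0 < (√(2 * Real.pi * (1 : ℝ≥0)))⁻¹ := by positivity
    simp only [gaussianPDFReal]
    generalize (√(2 * Real.pi * (1 : ℝ≥0)))⁻¹ = c at hc
    rw [Real.mul_rpow hc.le (Real.exp_pos _).le, Real.mul_rpow hc.le (Real.exp_pos _).le,
      mul_mul_mul_comm, ← Real.rpow_add hc, add_sub_cancel, Real.rpow_one, ← Real.exp_mul,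
      ← Real.exp_mul, ← Real.exp_add]
    gcongr
    simp only [NNReal.coe_one, smul_eq_mul]
    nlinarith [mul_nonneg (mul_nonneg hw₀.le hw₁'.le) (sq_nonneg (x - y))]
  have hφ_le : ∀ x, gaussianPDF 0 1 x ≤ ENNReal.ofReal (√(2 * Real.pi * (1 : ℝ≥0)))⁻¹ := by
    intro x
    refine ENNReal.ofReal_le_ofReal ?_
    rw [gaussianPDFReal]
    refine mul_le_of_le_one_right (by positivity) (Real.exp_le_one_iff.2 ?_)
    have := sq_nonneg (x - 0)
    rw [neg_div, neg_nonpos]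
    positivity
  have sup_ne_top : ∀ k : ℝ → ℝ≥0∞, (∀ x, k x ≤ 1) → ⨆ x, gaussianPDF 0 1 x * k x ≠ ∞ :=
    fun k hk ↦ ne_top_of_le_ne_top ENNReal.ofReal_ne_top <| iSup_le fun x ↦
      (mul_le_of_le_one_right' (hk x)).trans (hφ_le x)
  intro f g h hf hg hh hf_le hg_le hfgh
  rw [gaussianReal_of_var_ne_zero 0 one_ne_zero, lintegral_withDensity_eq_lintegral_mul _ hφ hf,
    lintegral_withDensity_eq_lintegral_mul _ hφ hg, lintegral_withDensity_eq_lintegral_mul _ hφ hh]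
  refine prekopa_leindler_real hw₀ hw₁ (hφ.mul hf) (hφ.mul hg) (hφ.mul hh) (sup_ne_top f hf_le)
    (sup_ne_top g hg_le) fun x y ↦ ?_
  simp only [Pi.mul_apply]
  rw [ENNReal.mul_rpow_of_nonneg _ _ hw₀.le, ENNReal.mul_rpow_of_nonneg _ _ hw₁'.le,
    mul_mul_mul_comm]
  exact mul_le_mul' (hφ_logConcave x y) (hfgh x y)

end SatisfiesPrekopaLeindler

theorem ProbabilityTheory.IsGaussian.exists_eq_multivariateGaussian {n : ℕ}
    (ν : Measure (EuclideanSpace ℝ (Fin n))) [IsGaussian ν] :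
    ∃ m S, ν = multivariateGaussian m S := by
  let b := (EuclideanSpace.basisFun (Fin n) ℝ).toBasis
  let S : Matrix (Fin n) (Fin n) ℝ := LinearMap.BilinForm.toMatrix b (covarianceBilin ν).toBilinForm
  have hS_apply : ∀ x y : EuclideanSpace ℝ (Fin n),
      covarianceBilin ν x y = x.ofLp ⬝ᵥ S.mulVec y.ofLp := by
    intro x y
    exact LinearMap.BilinForm.apply_eq_dotProduct_toMatrix_mulVec b _ x y
  have hS : S.PosSemidef := (LinearMap.isPosSemidef_iff_posSemidef_toMatrix b).1
    (LinearMap.BilinForm.isPosSemidef_iff.1 isPosSemidef_covarianceBilin)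
  refine ⟨∫ x, x ∂ν, S, IsGaussian.ext (by simp) ?_⟩
  ext x y
  rw [hS_apply, covarianceBilin_multivariateGaussian hS]

theorem ProbabilityTheory.IsGaussian.satisfiesPrekopaLeindler {n : ℕ} {w : ℝ} (hw₀ : 0 < w)
    (hw₁ : w < 1) (ν : Measure (EuclideanSpace ℝ (Fin n))) [IsGaussian ν] :
    SatisfiesPrekopaLeindler ν w := by
  obtain ⟨m, S, rfl⟩ := exists_eq_multivariateGaussian ν
  rw [multivariateGaussian, ← map_pi_eq_stdGaussian]
  refine ((SatisfiesPrekopaLeindler.pi fun _ ↦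
    SatisfiesPrekopaLeindler.gaussianReal_zero_one hw₀ hw₁).map (by fun_prop) fun x y ↦ ?_).map
    (by fun_prop) fun x y ↦ ?_
  · simp
  · simp only [map_add, map_smul]
    module

end Measures

theorem exists_seq_dual_separating_points (X : Type*) [NormedAddCommGroup X] [NormedSpace ℝ X]
    [SecondCountableTopology X] :
    ∃ l : ℕ → X →L[ℝ] ℝ, ∀ x y, (∀ n, l n x = l n y) → x = y := by
  obtain ⟨T, hT, hT_union⟩ := TopologicalSpace.isOpen_iUnion_countable
    (fun l : X →L[ℝ] ℝ ↦ {p : X × X | l p.1 ≠ l p.2})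
    fun l ↦ isOpen_ne_fun (by fun_prop) (by fun_prop)
  obtain ⟨l, hl⟩ := (hT.insert 0).exists_eq_range (Set.insert_nonempty 0 T)
  refine ⟨l, fun x y hxy ↦ by_contra fun hne ↦ ?_⟩
  obtain ⟨k, hk⟩ := SeparatingDual.exists_separating_of_ne (R := ℝ) hne
  have hmem : (x, y) ∈ ⋃ l ∈ T, {p : X × X | l p.1 ≠ l p.2} :=
    hT_union ▸ Set.mem_iUnion.2 ⟨k, hk⟩
  simp only [Set.mem_iUnion] at hmem
  obtain ⟨k', hk', hne'⟩ := hmem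
  obtain ⟨n, rfl⟩ : k' ∈ Set.range l := hl ▸ Set.mem_insert_of_mem 0 hk'
  exact hne' (hxy n)

section Banach

variable {X : Type*} [NormedAddCommGroup X] [NormedSpace ℝ X]
  [SecondCountableTopology X] [MeasurableSpace X] [BorelSpace X] {w : ℝ}

theorem ProbabilityTheory.IsGaussian.measure_rpow_mul_le_of_isCompact (γ : Measure X) [IsGaussian γ]
    (hw₀ : 0 < w) (hw₁ : w < 1) {K L M : Set X} (hK : IsCompact K) (hL : IsCompact L)
    (hM : IsCompact M) (hKLM : ∀ x ∈ K, ∀ y ∈ L, w • x + (1 - w) • y ∈ M) :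
    γ K ^ w * γ L ^ (1 - w) ≤ γ M := by
  obtain ⟨l, hl⟩ := exists_seq_dual_separating_points X
  let P (n : ℕ) : X →L[ℝ] EuclideanSpace ℝ (Fin n) :=
    (EuclideanSpace.equiv (Fin n) ℝ).symm.toContinuousLinearMap ∘L
      ContinuousLinearMap.pi fun i ↦ l i
  have hP : ∀ n x y, P n x = P n y ↔ ∀ i < n, l i x = l i y := by
    intro n x y
    simp [P, funext_iff, Fin.forall_iff]
  have hmeas : ∀ n {A : Set X}, IsCompact A → MeasurableSet (P n '' A) :=
    fun n A hA ↦ (hA.image (P n).continuous).measurableSet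
  have cylinder_le : ∀ n, γ K ^ w * γ L ^ (1 - w) ≤ γ (P n ⁻¹' (P n '' M)) := by
    intro n
    rw [← Measure.map_apply (P n).measurable (hmeas n hM)]
    refine le_trans ?_ <| (satisfiesPrekopaLeindler hw₀ hw₁ (γ.map (P n))).measure_rpow_mul_le
      hw₀ hw₁ (hmeas n hK) (hmeas n hL) (hmeas n hM) ?_
    · rw [Measure.map_apply (P n).measurable (hmeas n hK),
        Measure.map_apply (P n).measurable (hmeas n hL)]
      have := sub_nonneg.2 hw₁.le
      gcongr <;> exact Set.subset_preimage_image _ _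
    · rintro _ ⟨x, hx, rfl⟩ _ ⟨y, hy, rfl⟩
      exact ⟨_, hKLM x hx y hy, by simp⟩
  have hanti : Antitone fun n ↦ P n ⁻¹' (P n '' M) := by
    rintro n n' hn x ⟨m, hm, hmx⟩
    exact ⟨m, hm, (hP n m x).2 fun i hi ↦ (hP n' m x).1 hmx i (hi.trans_le hn)⟩
  have hinter : ⋂ n, P n ⁻¹' (P n '' M) ⊆ M := by
    intro x hx
    have hne : (⋂ n, M ∩ {m | P n m = P n x}).Nonempty := by
      refine IsCompact.nonempty_iInter_of_sequence_nonempty_isCompact_isClosed _ ?_ ?_ ?_ ?_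
      · intro n m hm
        exact ⟨hm.1, (hP n m x).2 fun i hi ↦ (hP (n + 1) m x).1 hm.2 i (by omega)⟩
      · intro n
        obtain ⟨m, hm, hmx⟩ := Set.mem_iInter.1 hx n
        exact ⟨m, hm, hmx⟩
      · exact hM.inter_right (isClosed_eq (P 0).continuous continuous_const)
      · exact fun n ↦ hM.isClosed.inter (isClosed_eq (P n).continuous continuous_const)
    obtain ⟨m, hm⟩ := hne
    rw [Set.mem_iInter] at hm
    have hmx : m = x := hl m x fun n ↦ (hP (n + 1) m x).1 (hm (n + 1)).2 n n.lt_succ_self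
    exact hmx ▸ (hm 0).1
  have hlim := tendsto_measure_iInter_atTop (μ := γ) (s := fun n ↦ P n ⁻¹' (P n '' M))
    (fun n ↦ ((P n).measurable (hmeas n hM)).nullMeasurableSet) hanti ⟨0, measure_ne_top _ _⟩
  exact (ge_of_tendsto' hlim cylinder_le).trans (measure_mono hinter)

/-- Gaussian measures on separable Banach spaces are logarithmically concave. -/
theorem ProbabilityTheory.IsGaussian.measure_rpow_mul_le [CompleteSpace X] (γ : Measure X)
    [IsGaussian γ] (hw₀ : 0 < w) (hw₁ : w < 1) {A B S : Set X} (hA : MeasurableSet A)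
    (hB : MeasurableSet B) (hABS : ∀ x ∈ A, ∀ y ∈ B, w • x + (1 - w) • y ∈ S) :
    γ A ^ w * γ B ^ (1 - w) ≤ γ S := by
  rw [hA.measure_eq_iSup_isCompact_subtype, hB.measure_eq_iSup_isCompact_subtype,
    ← ENNReal.orderIsoRpow_apply w hw₀, ← ENNReal.orderIsoRpow_apply (1 - w) (sub_pos.2 hw₁),
    OrderIso.map_iSup, OrderIso.map_iSup]
  simp only [ENNReal.iSup_mul, ENNReal.mul_iSup, iSup_le_iff, Subtype.forall,
    ENNReal.orderIsoRpow_apply]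
  rintro L ⟨hLB, hL⟩ K ⟨hKA, hK⟩
  refine (measure_rpow_mul_le_of_isCompact γ hw₀ hw₁ hK hL ((hK.smul w).add (hL.smul (1 - w)))
    fun x hx y hy ↦ Set.add_mem_add (Set.smul_mem_smul_set hx) (Set.smul_mem_smul_set hy)).trans
    (measure_mono ?_)
  rintro _ ⟨_, ⟨x, hx, rfl⟩, _, ⟨y, hy, rfl⟩, rfl⟩
  exact hABS x (hKA hx) y (hLB hy)

end Banach

/-- Let `X` be a separable Banach space, `γ` a centered Gaussian measure
on `X`, and `C ⊆ X` a convex Borel set. Then for all `t₁, t₂ > 0` and all `λ ∈ [0,1]`,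
`γ((λt₁ + (1−λ)t₂)C) ≥ γ(t₁C)^λ ⬝ γ(t₂C)^{1−λ}`; that is, `t ↦ log γ(tC)` is
concave on `(0,∞)`. -/
theorem gaussian_dilates_log_concave
    {X : Type*} [NormedAddCommGroup X] [NormedSpace ℝ X] [CompleteSpace X]
    [SecondCountableTopology X] [MeasurableSpace X] [BorelSpace X]
    (γ : Measure X) [IsProbabilityMeasure γ]
    (hγ : ∀ ℓ : X →L[ℝ] ℝ, ∃ v : ℝ≥0, γ.map ℓ = gaussianReal 0 v)
    (C : Set X) (hC : Convex ℝ C) (hCm : MeasurableSet C) :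
    ∀ t₁ t₂ : ℝ, 0 < t₁ → 0 < t₂ → ∀ lam : ℝ, lam ∈ Set.Icc (0 : ℝ) 1 →
      γ (t₁ • C) ^ lam * γ (t₂ • C) ^ (1 - lam) ≤ γ ((lam * t₁ + (1 - lam) * t₂) • C) := by
  intro t₁ t₂ ht₁ ht₂ w ⟨hw₀, hw₁⟩
  have : IsGaussian γ := isGaussian_of_map_eq_gaussianReal fun l ↦ ⟨0, hγ l⟩
  rcases hw₀.eq_or_lt with rfl | hw₀
  · simp
  rcases hw₁.eq_or_lt with rfl | hw₁
  · simp
  refine IsGaussian.measure_rpow_mul_le γ hw₀ hw₁ (hCm.const_smul₀ t₁) (hCm.const_smul₀ t₂) ?_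
  rintro _ ⟨x, hx, rfl⟩ _ ⟨y, hy, rfl⟩
  have hw₁' : 0 < 1 - w := sub_pos.2 hw₁
  rw [hC.add_smul (by positivity) (by positivity), mul_smul, mul_smul]
  exact Set.add_mem_add (Set.smul_mem_smul_set (Set.smul_mem_smul_set hx))
    (Set.smul_mem_smul_set (Set.smul_mem_smul_set hy))
end

section
/- Let X be a separable Banach space, γ a nondegenerate centered Gaussian measure on X, and C ⊆ X an open convex set. Then the topological boundary of C is γ-null: γ(∂C) = 0. -/
open MeasureTheory ProbabilityTheory
open scoped ENNReal NNReal

namespace ProbabilityTheory.IsGaussian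

variable {E : Type*} [NormedAddCommGroup E] [NormedSpace ℝ E] [CompleteSpace E]
  [SecondCountableTopology E] [MeasurableSpace E] [BorelSpace E]

lemma integrable_dual_smul_sub (μ : Measure E) [IsGaussian μ] (L : StrongDual ℝ E) (m : E) :
    Integrable (fun x ↦ L x • (x - m)) μ :=
  memLp_one_iff_integrable.1 <|
    ((memLp_two_id (μ := μ)).sub (memLp_const m)).smul (memLp_dual μ L 2 (by simp))

/-- The covariance operator of a Gaussian measure, sending a continuous linear functional `L` to
`∫ x, L x • (x - m) ∂μ`, where `m` is the mean of `μ`. -/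
noncomputable def covarianceOperator (μ : Measure E) [IsGaussian μ] : StrongDual ℝ E →ₗ[ℝ] E where
  toFun L := ∫ x, L x • (x - ∫ y, y ∂μ) ∂μ
  map_add' L₁ L₂ := by
    simp only [add_apply, add_smul]
    exact integral_add (integrable_dual_smul_sub μ L₁ _) (integrable_dual_smul_sub μ L₂ _)
  map_smul' c L := by
    simp only [smul_apply, smul_assoc, RingHom.id_apply]
    exact integral_smul c _

lemma apply_covarianceOperator (μ : Measure E) [IsGaussian μ] (L₁ L₂ : StrongDual ℝ E) :
    L₁ (covarianceOperator μ L₂) = cov[L₁, L₂; μ] := by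
  have h₁ := memLp_dual μ L₁ 2 (by simp)
  have h₂ := memLp_dual μ L₂ 2 (by simp)
  rw [covariance_eq_sub h₁ h₂]
  change L₁ (∫ x, L₂ x • (x - ∫ y, y ∂μ) ∂μ) = _
  rw [← L₁.integral_comp_comm (integrable_dual_smul_sub μ L₂ _)]
  simp only [map_smul, map_sub, smul_eq_mul, mul_sub]
  rw [integral_sub (show Integrable (fun x ↦ L₂ x * L₁ x) μ from h₂.integrable_mul h₁)
    ((integrable_dual μ L₂).mul_const _),
    integral_mul_const, ← integral_dual L₁, mul_comm (∫ x, L₂ x ∂μ)]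
  simp [mul_comm]

/-- A Gaussian measure factors along the direction of the covariance operator applied to `L`: the
component `L x` is independent of the remaining part of `x`. -/
lemma indepFun_sub_smul_covarianceOperator (μ : Measure E) [IsGaussian μ] (L : StrongDual ℝ E)
    (hL : Var[L; μ] ≠ 0) :
    IndepFun (fun x ↦ x - L x • (Var[L; μ])⁻¹ • covarianceOperator μ L) L μ := by
  set e := (Var[L; μ])⁻¹ • covarianceOperator μ L with he
  have hlaw : HasGaussianLaw (fun x ↦ (x - L x • e, L x)) μ :=
    (hasGaussianLaw_id (μ := μ)).map_fun
      ((ContinuousLinearMap.id ℝ E - L.smulRight e).prod L)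
  refine hlaw.indepFun_of_covariance_strongDual fun L₁ L₂ ↦ ?_
  have h₁ := memLp_dual μ L₁ 2 (by simp)
  have h₂ := memLp_dual μ L 2 (by simp)
  have e₁ : L₁ ∘ (fun x ↦ x - L x • e) = ⇑L₁ - fun x ↦ L x * L₁ e := by
    ext x; simp
  have e₂ : L₂ ∘ L = fun x ↦ L x * L₂ 1 := by
    ext x
    rw [Function.comp_apply, ← smul_eq_mul, ← map_smul, smul_eq_mul, mul_one]
  rw [e₁, e₂, covariance_mul_const_right, covariance_sub_left h₁ (h₂.mul_const _) h₂,
    covariance_mul_const_left, covariance_self h₂.aemeasurable, he, map_smul,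
    apply_covarianceOperator, smul_eq_mul]
  field_simp
  simp

/-- A measurable set meeting every line in the direction of the covariance operator applied to `L`
in at most one point is null. -/
lemma measure_eq_zero_of_subsingleton_line (μ : Measure E) [IsGaussian μ] (L : StrongDual ℝ E)
    (hL : Var[L; μ] ≠ 0) {A : Set E} (hA : MeasurableSet A)
    (hsub : ∀ y, {t : ℝ | y + t • covarianceOperator μ L ∈ A}.Subsingleton) : μ A = 0 := by
  set e := (Var[L; μ])⁻¹ • covarianceOperator μ L with he
  have hind := indepFun_sub_smul_covarianceOperator μ L hL
  rw [← he, indepFun_iff_map_prod_eq_prod_map_map (by fun_prop) (by fun_prop)] at hind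
  have hmeas : MeasurableSet {p : E × ℝ | p.1 + p.2 • e ∈ A} :=
    (show Measurable fun p : E × ℝ ↦ p.1 + p.2 • e by fun_prop) hA
  have hAeq : A = (fun x ↦ (x - L x • e, L x)) ⁻¹' {p : E × ℝ | p.1 + p.2 • e ∈ A} := by
    ext x; simp
  rw [hAeq, ← Measure.map_apply (by fun_prop) hmeas, hind]
  refine Measure.measure_prod_null_of_ae_null hmeas (.of_forall fun y ↦ ?_)
  have : NullSingletonClass (μ.map L) := by
    rw [map_eq_gaussianReal]
    refine nullSingletonClass_gaussianReal ?_
    simpa using (variance_nonneg _ _).lt_of_ne' hL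
  refine Set.Subsingleton.measure_zero (fun s hs t ht ↦ ?_) _
  have hs' : s * (Var[L; μ])⁻¹ ∈ {t : ℝ | y + t • covarianceOperator μ L ∈ A} := by
    simpa [he, mul_smul] using hs
  have ht' : t * (Var[L; μ])⁻¹ ∈ {t : ℝ | y + t • covarianceOperator μ L ∈ A} := by
    simpa [he, mul_smul] using ht
  exact mul_right_cancel₀ (inv_ne_zero hL) (hsub y hs' ht')

/-- If the functionals of variance zero vanish, then the range of the covariance operator meets
every nonempty open convex set. -/
lemma exists_covarianceOperator_mem (μ : Measure E) [IsGaussian μ]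
    (hμ : ∀ L : StrongDual ℝ E, Var[L; μ] = 0 → L = 0) {U : Set E} (hU : Convex ℝ U)
    (hUo : IsOpen U) (hne : U.Nonempty) : ∃ L, covarianceOperator μ L ∈ U := by
  by_contra! h
  obtain ⟨f, u, hfU, hfR⟩ := geometric_hahn_banach_open hU hUo
    (LinearMap.range (covarianceOperator μ)).convex
    (Set.disjoint_right.2 (by rintro _ ⟨L, rfl⟩; exact h L))
  obtain ⟨a, ha⟩ := hne
  have hbound (t : ℝ) : u ≤ t * Var[f; μ] := by
    have := hfR _ ⟨t • f, rfl⟩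
    rwa [map_smul, map_smul, apply_covarianceOperator, covariance_self (by fun_prop),
      smul_eq_mul] at this
  have hvar : Var[f; μ] = 0 := by
    by_contra hv
    have := hbound ((u - 1) / Var[f; μ])
    rw [div_mul_cancel₀ _ hv] at this
    linarith
  have h0 := hbound 0
  have hfa := hfU a ha
  rw [hμ f hvar, zero_apply] at hfa
  linarith

end ProbabilityTheory.IsGaussian

/-- The points of the frontier of an open convex set from which translation by `e` leads into the
set meet every line in the direction `e` at most once. -/
lemma Convex.subsingleton_frontier_line {E : Type*} [AddCommGroup E] [Module ℝ E]
    [TopologicalSpace E] [IsTopologicalAddGroup E] [ContinuousSMul ℝ E] {C : Set E}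
    (hC : Convex ℝ C) (hCo : IsOpen C) (e y : E) :
    {t : ℝ | y + t • e ∈ frontier C ∩ {x | x + e ∈ C}}.Subsingleton := by
  have key (s t : ℝ) (hst : s < t) (hs : y + s • e ∈ frontier C) (ht : y + t • e ∈ frontier C)
      (hte : y + t • e + e ∈ C) : False := by
    have hpos : 0 < t + 1 - s := by linarith
    have hmem := hC.combo_closure_interior_mem_interior (a := 1 / (t + 1 - s))
      (b := (t - s) / (t + 1 - s)) hs.1 (hCo.interior_eq.symm ▸ hte) (by positivity)
      (div_pos (by linarith) hpos) (by field_simp; ring)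
    refine ht.2 ?_
    convert hmem using 1
    match_scalars <;> field_simp <;> ring
  rintro s ⟨hs, hse⟩ t ⟨ht, hte⟩
  rcases lt_trichotomy s t with h | h | h
  · exact (key s t h hs ht hte).elim
  · exact h
  · exact (key t s h ht hs hse).elim

/-- Let `X` be a separable Banach space, `γ` a nondegenerate centered
Gaussian measure on `X` (the pushforward of `γ` under every continuous linear functional
is a centered Gaussian measure on `ℝ`, which is not a Dirac mass when the functional is
nonzero), and `C ⊆ X` an open convex set. Then `γ(∂C) = 0`. -/
theorem gaussian_measure_frontier_convex_open
    {X : Type*} [NormedAddCommGroup X] [NormedSpace ℝ X] [CompleteSpace X]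
    [SecondCountableTopology X] [MeasurableSpace X] [BorelSpace X]
    (γ : Measure X) [IsProbabilityMeasure γ]
    (hγ : ∀ ℓ : X →L[ℝ] ℝ, ∃ v : ℝ≥0, γ.map ℓ = gaussianReal 0 v)
    (hnd : ∀ ℓ : X →L[ℝ] ℝ, ℓ ≠ 0 → ∀ c : ℝ, γ.map ℓ ≠ Measure.dirac c)
    (C : Set X) (hC : Convex ℝ C) (hCo : IsOpen C) :
    γ (frontier C) = 0 := by
  have : IsGaussian γ := isGaussian_of_map_eq_gaussianReal fun L ↦ ⟨0, hγ L⟩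
  have hvar (L : StrongDual ℝ X) (hL : Var[L; γ] = 0) : L = 0 := by
    by_contra hne
    refine hnd L hne (∫ x, L x ∂γ) ?_
    rw [IsGaussian.map_eq_gaussianReal, hL, Real.toNNReal_zero, gaussianReal_zero_var]
  refine measure_null_of_locally_null _ fun x hx ↦ ?_
  obtain ⟨c, hc⟩ := closure_nonempty_iff.1 ⟨x, hx.1⟩
  obtain ⟨L, hL⟩ := IsGaussian.exists_covarianceOperator_mem γ hvar
    (hC.translate_preimage_right x) (hCo.preimage (by fun_prop))
    ⟨c - x, by simpa using hc⟩
  set e := IsGaussian.covarianceOperator γ L with he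
  have hopen : IsOpen {z | z + e ∈ C} := hCo.preimage (by fun_prop)
  refine ⟨frontier C ∩ {z | z + e ∈ C},
    Filter.inter_mem self_mem_nhdsWithin (mem_nhdsWithin_of_mem_nhds (hopen.mem_nhds hL)), ?_⟩
  refine IsGaussian.measure_eq_zero_of_subsingleton_line γ L (fun h0 ↦ ?_)
    (measurableSet_frontier.inter hopen.measurableSet) (hC.subsingleton_frontier_line hCo e)
  have hxe : x + e ∈ C := hL
  rw [he, hvar L h0, map_zero, add_zero] at hxe
  exact hx.2 (hCo.interior_eq.symm ▸ hxe)
end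

section
/- Let X be a separable Banach space, γ a nondegenerate centered Gaussian measure on X, and C ⊆ X an open convex set with 0 ∈ C. Then there exists M > 0 such that γ((1+η)C) − γ(C) ≤ M·η for every η ∈ (0,1). -/
open MeasureTheory ProbabilityTheory
open scoped Pointwise ENNReal NNReal

theorem volume_add_volume_le_of_isCompact {s t u : Set ℝ} (hs : IsCompact s) (ht : IsCompact t)
    (hs' : s.Nonempty) (ht' : t.Nonempty) (h : ∀ x ∈ s, ∀ y ∈ t, x + y ∈ u) :
    volume s + volume t ≤ volume u := by
  obtain ⟨x, hx, hxs⟩ := hs.exists_isGreatest hs'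
  obtain ⟨y, hy, hyt⟩ := ht.exists_isLeast ht'
  have h1 : volume ((fun z ↦ y + z) '' s) = volume s := by
    simp [Set.image_add_left]
  have h2 : volume ((fun z ↦ x + z) '' t) = volume t := by
    simp [Set.image_add_left]
  have hd : AEDisjoint volume ((fun z ↦ y + z) '' s) ((fun z ↦ x + z) '' t) := by
    refine measure_mono_null (t := {x + y}) ?_ (by simp)
    rintro _ ⟨⟨p, hp, rfl⟩, ⟨q, hq, hpq⟩⟩
    have := hxs hp
    have := hyt hq
    simp only [Set.mem_singleton_iff] at *
    linarith
  rw [← h1, ← h2, ← measure_union₀ (ht.image (by fun_prop)).measurableSet.nullMeasurableSet hd]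
  refine measure_mono ?_
  rintro _ (⟨p, hp, rfl⟩ | ⟨q, hq, rfl⟩)
  · simpa [add_comm] using h p hp y hy
  · exact h x hx q hq

/-- The Brunn-Minkowski inequality on the real line. -/
theorem volume_add_volume_le {s t u : Set ℝ} (hs : MeasurableSet s) (ht : MeasurableSet t)
    (hs' : s.Nonempty) (ht' : t.Nonempty) (h : ∀ x ∈ s, ∀ y ∈ t, x + y ∈ u) :
    volume s + volume t ≤ volume u := by
  obtain ⟨x, hx⟩ := hs'
  obtain ⟨y, hy⟩ := ht'
  rw [hs.measure_eq_iSup_isCompact, ht.measure_eq_iSup_isCompact]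
  simp only [iSup_and']
  refine ENNReal.biSup_add_biSup_le' ⟨∅, by simp⟩ ⟨∅, by simp⟩ ?_
  rintro K ⟨hKs, hK⟩ L ⟨hLt, hL⟩
  calc volume K + volume L ≤ volume (insert x K) + volume (insert y L) := by
        gcongr <;> exact Set.subset_insert _ _
    _ ≤ volume u := by
        refine volume_add_volume_le_of_isCompact (hK.insert x) (hL.insert y) (by simp) (by simp) ?_
        intro p hp q hq
        exact h p (Set.insert_subset hx hKs hp) q (Set.insert_subset hy hLt hq)

theorem volume_convexComb_le {a b : ℝ} (ha : 0 < a) (hb : 0 < b) {s t u : Set ℝ}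
    (hs : MeasurableSet s) (ht : MeasurableSet t)
    (hs' : s.Nonempty) (ht' : t.Nonempty) (h : ∀ x ∈ s, ∀ y ∈ t, a * x + b * y ∈ u) :
    ENNReal.ofReal a * volume s + ENNReal.ofReal b * volume t ≤ volume u := by
  have key := volume_add_volume_le (hs.const_smul_of_ne_zero ha.ne')
    (ht.const_smul_of_ne_zero hb.ne') hs'.smul_set ht'.smul_set (u := u) ?_
  · simpa [Measure.addHaar_smul, abs_of_pos, ha, hb] using key
  · rintro _ ⟨x, hx, rfl⟩ _ ⟨y, hy, rfl⟩
    exact h x hx y hy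

/-- One-dimensional Prékopa-Leindler, for functions with supremum one. -/
theorem lintegral_convexComb_le {a b : ℝ} (ha : 0 < a) (hb : 0 < b) (hab : a + b = 1)
    {f g h : ℝ → ℝ} (hf : Measurable f) (hg : Measurable g) (hh : Measurable h)
    (hf0 : ∀ x, 0 ≤ f x) (hg0 : ∀ x, 0 ≤ g x) (hh0 : ∀ x, 0 ≤ h x)
    (hf1 : ∀ x, f x ≤ 1) (hg1 : ∀ x, g x ≤ 1)
    (hfs : ∀ r < 1, ∃ x, r < f x) (hgs : ∀ r < 1, ∃ x, r < g x)
    (H : ∀ x y, f x ^ a * g y ^ b ≤ h (a * x + b * y)) :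
    ENNReal.ofReal a * (∫⁻ x, ENNReal.ofReal (f x))
      + ENNReal.ofReal b * (∫⁻ x, ENNReal.ofReal (g x)) ≤ ∫⁻ x, ENNReal.ofReal (h x) := by
  have layer {k : ℝ → ℝ} (hk : Measurable k) (hk0 : ∀ x, 0 ≤ k x) (hk1 : ∀ x, k x ≤ 1) :
      ∫⁻ x, ENNReal.ofReal (k x) = ∫⁻ r in Set.Ioo (0 : ℝ) 1, volume {x | r < k x} := by
    rw [lintegral_eq_lintegral_meas_lt _ (.of_forall hk0) hk.aemeasurable]
    rw [← Set.Ioo_union_Ici_eq_Ioi (zero_lt_one (α := ℝ)),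
      lintegral_union measurableSet_Ici (Set.disjoint_left.2 fun r h1 h2 ↦ h1.2.not_ge h2),
      setLIntegral_eq_zero measurableSet_Ici fun r hr ↦ ?_, add_zero]
    simp [show ∀ x, ¬ r < k x from fun x ↦ ((hk1 x).trans hr).not_gt]
  have meas {k : ℝ → ℝ} : Measurable fun r : ℝ ↦ volume {x | r < k x} :=
    Antitone.measurable fun r r' hr ↦ measure_mono fun x hx ↦ lt_of_le_of_lt hr hx
  rw [layer hf hf0 hf1, layer hg hg0 hg1, ← lintegral_const_mul _ meas,
    ← lintegral_const_mul _ meas, ← lintegral_add_left (meas.const_mul _),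
    lintegral_eq_lintegral_meas_lt _ (.of_forall hh0) hh.aemeasurable]
  refine (setLIntegral_mono' measurableSet_Ioo fun r hr ↦ ?_).trans
    (lintegral_mono_set Set.Ioo_subset_Ioi_self)
  refine volume_convexComb_le ha hb (measurableSet_lt measurable_const hf)
    (measurableSet_lt measurable_const hg) (hfs r hr.2) (hgs r hr.2) fun x hx y hy ↦ ?_
  calc r = r ^ a * r ^ b := by rw [← Real.rpow_add hr.1, hab, Real.rpow_one]
    _ < f x ^ a * g y ^ b := by
        have := hr.1
        gcongr
        · exact hx
        · exact hy
    _ ≤ h (a * x + b * y) := H x y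

/-- The one-dimensional Prékopa-Leindler inequality for bounded functions. -/
theorem prekopaLeindler_real {a b : ℝ} (ha : 0 < a) (hb : 0 < b) (hab : a + b = 1)
    {f g h : ℝ → ℝ} (hf : Integrable f) (hg : Integrable g) (hh : Integrable h)
    (hfm : Measurable f) (hgm : Measurable g) (hhm : Measurable h)
    (hf0 : ∀ x, 0 ≤ f x) (hg0 : ∀ x, 0 ≤ g x) (hh0 : ∀ x, 0 ≤ h x)
    (hfb : BddAbove (Set.range f)) (hgb : BddAbove (Set.range g))
    (H : ∀ x y, f x ^ a * g y ^ b ≤ h (a * x + b * y)) :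
    (∫ x, f x) ^ a * (∫ x, g x) ^ b ≤ ∫ x, h x := by
  have hI : 0 ≤ ∫ x, h x := integral_nonneg hh0
  by_cases hf_zero : ∀ x, f x = 0
  · simpa [hf_zero, Real.zero_rpow ha.ne'] using hI
  by_cases hg_zero : ∀ x, g x = 0
  · simpa [hg_zero, Real.zero_rpow hb.ne'] using hI
  push Not at hf_zero hg_zero
  obtain ⟨x₀, hx₀⟩ := hf_zero
  obtain ⟨y₀, hy₀⟩ := hg_zero
  set A := ⨆ x, f x
  set B := ⨆ x, g x
  have hA : 0 < A := ((hf0 x₀).lt_of_ne' hx₀).trans_le (le_ciSup hfb x₀)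
  have hB : 0 < B := ((hg0 y₀).lt_of_ne' hy₀).trans_le (le_ciSup hgb y₀)
  have hD : 0 < A ^ a * B ^ b := by positivity
  have key := lintegral_convexComb_le ha hb hab (f := fun x ↦ f x / A) (g := fun x ↦ g x / B)
    (h := fun x ↦ h x / (A ^ a * B ^ b)) (by fun_prop) (by fun_prop) (by fun_prop)
    (fun x ↦ div_nonneg (hf0 x) hA.le) (fun x ↦ div_nonneg (hg0 x) hB.le)
    (fun x ↦ div_nonneg (hh0 x) hD.le)
    (fun x ↦ (div_le_one hA).2 (le_ciSup hfb x)) (fun x ↦ (div_le_one hB).2 (le_ciSup hgb x))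
    (fun r hr ↦ by
      obtain ⟨x, hx⟩ := exists_lt_of_lt_ciSup (show r * A < ⨆ x, f x from
        mul_lt_of_lt_one_left hA hr)
      exact ⟨x, (lt_div_iff₀ hA).2 hx⟩)
    (fun r hr ↦ by
      obtain ⟨x, hx⟩ := exists_lt_of_lt_ciSup (show r * B < ⨆ x, g x from
        mul_lt_of_lt_one_left hB hr)
      exact ⟨x, (lt_div_iff₀ hB).2 hx⟩)
    (fun x y ↦ by
      rw [Real.div_rpow (hf0 x) hA.le, Real.div_rpow (hg0 y) hB.le, div_mul_div_comm]
      gcongr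
      exact H x y)
  rw [← ofReal_integral_eq_lintegral_ofReal (hf.div_const A)
      (.of_forall fun x ↦ div_nonneg (hf0 x) hA.le),
    ← ofReal_integral_eq_lintegral_ofReal (hg.div_const B)
      (.of_forall fun x ↦ div_nonneg (hg0 x) hB.le),
    ← ofReal_integral_eq_lintegral_ofReal (hh.div_const _)
      (.of_forall fun x ↦ div_nonneg (hh0 x) hD.le),
    integral_div, integral_div, integral_div, ← ENNReal.ofReal_mul ha.le,
    ← ENNReal.ofReal_mul hb.le] at key
  have hIf : 0 ≤ ∫ x, f x := integral_nonneg hf0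
  have hIg : 0 ≤ ∫ x, g x := integral_nonneg hg0
  rw [← ENNReal.ofReal_add (by positivity) (by positivity),
    ENNReal.ofReal_le_ofReal_iff (by positivity)] at key
  have amgm := Real.geom_mean_le_arith_mean2_weighted ha.le hb.le
    (div_nonneg hIf hA.le) (div_nonneg hIg hB.le) hab
  rw [Real.div_rpow hIf hA.le, Real.div_rpow hIg hB.le, div_mul_div_comm] at amgm
  exact (div_le_div_iff_of_pos_right hD).1 (amgm.trans key)

/-- A measure satisfies the Prékopa-Leindler inequality if it is log-concave at the level of
functions with values in the unit interval. -/
def PrekopaLeindler {E : Type*} [AddCommGroup E] [Module ℝ E] [MeasurableSpace E]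
    (μ : Measure E) : Prop :=
  ∀ a b : ℝ, 0 < a → 0 < b → a + b = 1 → ∀ f g h : E → ℝ,
    Measurable f → Measurable g → Measurable h →
    (∀ x, f x ∈ Set.Icc 0 1) → (∀ x, g x ∈ Set.Icc 0 1) → (∀ x, h x ∈ Set.Icc 0 1) →
    (∀ x y, f x ^ a * g y ^ b ≤ h (a • x + b • y)) →
    (∫ x, f x ∂μ) ^ a * (∫ x, g x ∂μ) ^ b ≤ ∫ x, h x ∂μ

theorem integrable_of_mem_Icc {α : Type*} [MeasurableSpace α] {μ : Measure α} [IsFiniteMeasure μ]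
    {f : α → ℝ} (hf : Measurable f) (h : ∀ x, f x ∈ Set.Icc 0 1) : Integrable f μ :=
  .of_mem_Icc 0 1 hf.aemeasurable (.of_forall h)

theorem integral_mem_Icc {α : Type*} [MeasurableSpace α] {μ : Measure α} [IsProbabilityMeasure μ]
    {f : α → ℝ} (hf : Measurable f) (h : ∀ x, f x ∈ Set.Icc 0 1) :
    ∫ x, f x ∂μ ∈ Set.Icc 0 1 :=
  ⟨integral_nonneg fun x ↦ (h x).1, by
    simpa using integral_mono (integrable_of_mem_Icc (μ := μ) hf h) (integrable_const (1 : ℝ))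
      fun x ↦ (h x).2⟩

theorem prekopaLeindler_gaussianReal : PrekopaLeindler (gaussianReal 0 1) := by
  intro a b ha hb hab f g h hf hg hh hf' hg' hh' H
  simp_rw [integral_gaussianReal_eq_integral_smul one_ne_zero, smul_eq_mul]
  have hI {k : ℝ → ℝ} (hk : Measurable k) (hk' : ∀ x, k x ∈ Set.Icc 0 1) :
      Integrable fun x ↦ gaussianPDFReal 0 1 x * k x :=
    (integrable_gaussianPDFReal 0 1).mul_bdd (c := 1) hk.aestronglyMeasurable
      (.of_forall fun x ↦ by simpa [abs_of_nonneg (hk' x).1] using (hk' x).2)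
  have hM {k : ℝ → ℝ} (hk : Measurable k) : Measurable fun x ↦ gaussianPDFReal 0 1 x * k x :=
    (measurable_gaussianPDFReal 0 1).mul hk
  have h0 {k : ℝ → ℝ} (hk' : ∀ x, k x ∈ Set.Icc 0 1) (x : ℝ) : 0 ≤ gaussianPDFReal 0 1 x * k x :=
    mul_nonneg (gaussianPDFReal_nonneg 0 1 x) (hk' x).1
  have hB {k : ℝ → ℝ} (hk' : ∀ x, k x ∈ Set.Icc 0 1) :
      BddAbove (Set.range fun x ↦ gaussianPDFReal 0 1 x * k x) := by
    refine ⟨(√(2 * Real.pi * (1 : ℝ≥0)))⁻¹, ?_⟩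
    rintro _ ⟨x, rfl⟩
    refine (mul_le_of_le_one_right (gaussianPDFReal_nonneg 0 1 x) (hk' x).2).trans ?_
    refine mul_le_of_le_one_right (by positivity) (Real.exp_le_one_iff.2 ?_)
    simp only [NNReal.coe_one]
    nlinarith [sq_nonneg (x - 0)]
  refine prekopaLeindler_real ha hb hab (hI hf hf') (hI hg hg') (hI hh hh') (hM hf) (hM hg) (hM hh)
    (h0 hf') (h0 hg') (h0 hh') (hB hf') (hB hg') fun x y ↦ ?_
  rw [Real.mul_rpow (gaussianPDFReal_nonneg _ _ _) (hf' x).1,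
    Real.mul_rpow (gaussianPDFReal_nonneg _ _ _) (hg' y).1, mul_mul_mul_comm]
  refine mul_le_mul ?_ (H x y)
    (mul_nonneg (Real.rpow_nonneg (hf' x).1 _) (Real.rpow_nonneg (hg' y).1 _))
    (gaussianPDFReal_nonneg _ _ _)
  have hc : 0 < (√(2 * Real.pi * (1 : ℝ≥0)))⁻¹ := by positivity
  rw [gaussianPDFReal, gaussianPDFReal, gaussianPDFReal, Real.mul_rpow hc.le (Real.exp_nonneg _),
    Real.mul_rpow hc.le (Real.exp_nonneg _), mul_mul_mul_comm, ← Real.rpow_add hc, hab,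
    Real.rpow_one, ← Real.exp_mul, ← Real.exp_mul, ← Real.exp_add]
  gcongr
  obtain rfl : b = 1 - a := by linarith
  simp only [NNReal.coe_one]
  nlinarith [mul_nonneg (mul_pos ha hb).le (sq_nonneg (x - y))]

theorem PrekopaLeindler.prod {E F : Type*} [AddCommGroup E] [Module ℝ E] [MeasurableSpace E]
    [AddCommGroup F] [Module ℝ F] [MeasurableSpace F] {μ : Measure E} {ν : Measure F}
    [IsProbabilityMeasure μ] [IsProbabilityMeasure ν]
    (hμ : PrekopaLeindler μ) (hν : PrekopaLeindler ν) : PrekopaLeindler (μ.prod ν) := by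
  intro a b ha hb hab f g h hf hg hh hf' hg' hh' H
  have hM {k : E × F → ℝ} (hk : Measurable k) : Measurable fun x ↦ ∫ y, k (x, y) ∂ν :=
    (hk.stronglyMeasurable.integral_prod_right' (ν := ν)).measurable
  have hI {k : E × F → ℝ} (hk : Measurable k) (hk' : ∀ x, k x ∈ Set.Icc 0 1) (x : E) :
      ∫ y, k (x, y) ∂ν ∈ Set.Icc 0 1 :=
    integral_mem_Icc (hk.comp measurable_prodMk_left) fun y ↦ hk' (x, y)
  rw [integral_prod _ (integrable_of_mem_Icc hf hf'), integral_prod _ (integrable_of_mem_Icc hg hg'),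
    integral_prod _ (integrable_of_mem_Icc hh hh')]
  refine hμ a b ha hb hab _ _ _ (hM hf) (hM hg) (hM hh) (hI hf hf') (hI hg hg') (hI hh hh')
    fun x y ↦ ?_
  exact hν a b ha hb hab _ _ _ (hf.comp measurable_prodMk_left) (hg.comp measurable_prodMk_left)
    (hh.comp measurable_prodMk_left) (fun _ ↦ hf' _) (fun _ ↦ hg' _) (fun _ ↦ hh' _)
    fun u v ↦ H (x, u) (y, v)

theorem PrekopaLeindler.map {E F : Type*} [AddCommGroup E] [Module ℝ E] [MeasurableSpace E]
    [AddCommGroup F] [Module ℝ F] [MeasurableSpace F] {μ : Measure E}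
    (hμ : PrekopaLeindler μ) (L : E →ₗ[ℝ] F) (hL : Measurable L) : PrekopaLeindler (μ.map L) := by
  intro a b ha hb hab f g h hf hg hh hf' hg' hh' H
  rw [integral_map hL.aemeasurable hf.aestronglyMeasurable,
    integral_map hL.aemeasurable hg.aestronglyMeasurable,
    integral_map hL.aemeasurable hh.aestronglyMeasurable]
  exact hμ a b ha hb hab _ _ _ (hf.comp hL) (hg.comp hL) (hh.comp hL) (fun _ ↦ hf' _)
    (fun _ ↦ hg' _) (fun _ ↦ hh' _) fun x y ↦ by simpa using H (L x) (L y)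

theorem prekopaLeindler_pi_gaussianReal (n : ℕ) :
    PrekopaLeindler (Measure.pi fun _ : Fin n ↦ gaussianReal 0 1) := by
  induction n with
  | zero =>
    intro a b ha hb hab f g h hf hg hh hf' hg' hh' H
    rw [Measure.pi_of_empty (x := 0)]
    simpa using H 0 0
  | succ n ih =>
    have hmp := (measurePreserving_piFinSuccAbove (fun _ : Fin (n + 1) ↦ gaussianReal 0 1) 0).symm
    rw [← hmp.map_eq]
    let L : ℝ × (Fin n → ℝ) →ₗ[ℝ] (Fin (n + 1) → ℝ) :=
      { toFun := fun p ↦ Fin.cons p.1 p.2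
        map_add' := fun p q ↦ by ext i; refine Fin.cases ?_ (fun j ↦ ?_) i <;> simp
        map_smul' := fun c p ↦ by ext i; refine Fin.cases ?_ (fun j ↦ ?_) i <;> simp }
    have hL : ⇑(MeasurableEquiv.piFinSuccAbove (fun _ : Fin (n + 1) ↦ ℝ) 0).symm = L := by
      ext p i
      simp [L, MeasurableEquiv.piFinSuccAbove_symm_apply, Fin.insertNthEquiv]
    rw [hL]
    exact (prekopaLeindler_gaussianReal.prod ih).map L (hL ▸ hmp.measurable)

open scoped MatrixOrder in
theorem prekopaLeindler_multivariateGaussian {n : ℕ} (S : Matrix (Fin n) (Fin n) ℝ) :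
    PrekopaLeindler (multivariateGaussian 0 S) := by
  have h : PrekopaLeindler (stdGaussian (EuclideanSpace ℝ (Fin n))) := by
    rw [← map_pi_eq_stdGaussian]
    exact (prekopaLeindler_pi_gaussianReal n).map
      (WithLp.linearEquiv 2 ℝ (Fin n → ℝ)).symm.toLinearMap (by fun_prop)
  simp only [multivariateGaussian, zero_add]
  exact h.map (Matrix.toEuclideanCLM (𝕜 := ℝ) (CFC.sqrt S)).toLinearMap (by fun_prop)

theorem prekopaLeindler_of_isGaussian {n : ℕ} (μ : Measure (EuclideanSpace ℝ (Fin n)))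
    [IsGaussian μ] (hμ : ∫ x, x ∂μ = 0) : PrekopaLeindler μ := by
  let e := (EuclideanSpace.basisFun (Fin n) ℝ).toBasis
  let S := LinearMap.toMatrix₂ e e (covarianceBilin μ).toBilinForm
  have hS : S.PosSemidef :=
    (LinearMap.isPosSemidef_iff_posSemidef_toMatrix e).1
      (LinearMap.BilinForm.isPosSemidef_iff.1 isPosSemidef_covarianceBilin)
  have : μ = multivariateGaussian 0 S := by
    refine IsGaussian.ext (by simpa using hμ) ?_
    ext x y
    rw [covarianceBilin_multivariateGaussian hS]
    exact LinearMap.BilinForm.apply_eq_dotProduct_toMatrix_mulVec e (covarianceBilin μ).toBilinForm x y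
  rw [this]
  exact prekopaLeindler_multivariateGaussian S

section Banach

variable {X : Type*} [NormedAddCommGroup X] [NormedSpace ℝ X] [CompleteSpace X]
  [SecondCountableTopology X] [MeasurableSpace X] [BorelSpace X]
  {γ : Measure X} [IsGaussian γ]

theorem measure_ball_zero_pos_of_isGaussian (hγ : ∫ x, x ∂γ = 0) {r : ℝ} (hr : 0 < r) :
    0 < γ (Metric.ball 0 r) := by
  obtain ⟨x, hx⟩ := Measure.nonempty_support (μ := γ) (NeZero.ne γ)
  rw [Measure.mem_support_iff_forall] at hx
  have hpos := hx _ (Metric.ball_mem_nhds x (half_pos hr))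
  have hrot := IsGaussian.map_rotation_eq_self (μ := γ) hγ (-(Real.pi / 4))
  calc 0 < (γ.prod γ) (Metric.ball x (r / 2) ×ˢ Metric.ball x (r / 2)) := by
        rw [Measure.prod_prod]
        exact ENNReal.mul_pos hpos.ne' hpos.ne'
    _ ≤ (γ.prod γ) (ContinuousLinearMap.rotation (-(Real.pi / 4)) ⁻¹'
          (Metric.ball 0 r ×ˢ Set.univ)) := by
        refine measure_mono ?_
        rintro ⟨y, z⟩ ⟨hy, hz⟩
        have hyz : ‖y - z‖ < r := by
          rw [← dist_eq_norm]
          linarith [dist_triangle_right y z x, Metric.mem_ball.1 hy, Metric.mem_ball.1 hz]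
        have hs : ‖(√2 / 2 : ℝ)‖ ≤ 1 := by
          rw [Real.norm_of_nonneg (by positivity)]
          nlinarith [Real.sq_sqrt (show (0 : ℝ) ≤ 2 by norm_num), Real.sqrt_nonneg 2]
        have hrw : (√2 / 2) • y + (-(√2 / 2)) • z = (√2 / 2) • (y - z) := by module
        simp only [Set.mem_preimage, ContinuousLinearMap.rotation_apply, Set.mem_prod,
          Real.cos_neg, Real.sin_neg, Real.cos_pi_div_four, Real.sin_pi_div_four,
          mem_ball_zero_iff, Set.mem_univ, and_true, hrw, norm_smul]
        exact (mul_le_of_le_one_left (norm_nonneg _) hs).trans_lt hyz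
    _ = γ (Metric.ball 0 r) := by
        rw [← Measure.map_apply (by fun_prop) (measurableSet_ball.prod .univ), hrot,
          Measure.prod_prod, measure_univ, mul_one]

theorem measureReal_polyhedron_logConcave (hγ : ∫ x, x ∂γ = 0) {n : ℕ} (l : Fin n → X →L[ℝ] ℝ)
    (c : Fin n → ℝ) {a b : ℝ} (ha : 0 < a) (hb : 0 < b) (hab : a + b = 1) (s t : ℝ) :
    γ.real {x | ∀ i, l i x ≤ s * c i} ^ a * γ.real {x | ∀ i, l i x ≤ t * c i} ^ b
      ≤ γ.real {x | ∀ i, l i x ≤ (a * s + b * t) * c i} := by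
  let L : X →L[ℝ] EuclideanSpace ℝ (Fin n) :=
    (EuclideanSpace.equiv (Fin n) ℝ).symm.toContinuousLinearMap ∘L ContinuousLinearMap.pi l
  have hmean : ∫ y, y ∂(γ.map L) = 0 := by
    rw [integral_map (by fun_prop) (by fun_prop),
      L.integral_comp_comm IsGaussian.integrable_fun_id, hγ, map_zero]
  let K (r : ℝ) : Set (EuclideanSpace ℝ (Fin n)) := {y | ∀ i, y i ≤ r * c i}
  have hK (r : ℝ) : MeasurableSet (K r) := by
    simp only [K, Set.ofPred_forall]
    exact .iInter fun i ↦ measurableSet_le (by fun_prop) measurable_const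
  have hind (r : ℝ) (y) : (K r).indicator (1 : EuclideanSpace ℝ (Fin n) → ℝ) y ∈ Set.Icc 0 1 := by
    by_cases hy : y ∈ K r <;> simp [hy]
  have key := prekopaLeindler_of_isGaussian (γ.map L) hmean a b ha hb hab
    ((K s).indicator 1) ((K t).indicator 1) ((K (a * s + b * t)).indicator 1)
    (measurable_one.indicator (hK _)) (measurable_one.indicator (hK _))
    (measurable_one.indicator (hK _)) (hind s) (hind t) (hind _) fun x y ↦ ?_
  · rw [integral_indicator_one (hK _), integral_indicator_one (hK _),
      integral_indicator_one (hK _), map_measureReal_apply (by fun_prop) (hK _),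
      map_measureReal_apply (by fun_prop) (hK _), map_measureReal_apply (by fun_prop) (hK _)] at key
    exact key
  · by_cases hx : x ∈ K s
    · by_cases hy : y ∈ K t
      · have hxy : a • x + b • y ∈ K (a * s + b * t) := fun i ↦ by
          have h1 := mul_le_mul_of_nonneg_left (hx i) ha.le
          have h2 := mul_le_mul_of_nonneg_left (hy i) hb.le
          simp only [PiLp.add_apply, PiLp.smul_apply, smul_eq_mul]
          linarith
        simp [hx, hy, hxy]
      · simpa [hx, hy, Real.zero_rpow hb.ne'] using (hind _ _).1
    · simpa [hx, Real.zero_rpow ha.ne'] using (hind _ _).1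

/-- For an open convex neighbourhood of the origin, the measure of the dilates is log-concave up to
an arbitrarily small loss in the dilation factor. -/
theorem measureReal_dilate_logConcave (hγ : ∫ x, x ∂γ = 0) {C : Set X} (hC : Convex ℝ C)
    (hCo : IsOpen C) (h0 : 0 ∈ C) {a b s t : ℝ} (ha : 0 < a) (hb : 0 < b) (hab : a + b = 1)
    (hs : 0 < s) (ht : 0 < t) (hst : a * s + b * t < 1) :
    γ.real (s • C) ^ a * γ.real (t • C) ^ b ≤ γ.real C := by
  obtain ⟨l, c, hlc⟩ := RCLike.iInter_countable_halfSpaces_eq (𝕜 := ℝ) hC.closure isClosed_closure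
  simp only [RCLike.re_to_real] at hlc
  have hCl {x : X} (hx : x ∈ C) (n : ℕ) : l n x ≤ c n :=
    Set.mem_iInter.1 (hlc.ge (subset_closure hx)) n
  have hr : 0 < a * s + b * t := by positivity
  let D (n : ℕ) (r : ℝ) : Set X := {x | ∀ i : Fin n, l i x ≤ r * c i}
  have hsub {r : ℝ} (hr : 0 < r) (n : ℕ) : r • C ⊆ D n r := by
    rintro _ ⟨x, hx, rfl⟩ i
    simpa using mul_le_mul_of_nonneg_left (hCl hx i) hr.le
  have hD (n : ℕ) (r : ℝ) : MeasurableSet (D n r) := by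
    simp only [D, Set.ofPred_forall]
    exact .iInter fun i ↦ measurableSet_le (by fun_prop) measurable_const
  have hanti (r : ℝ) : Antitone fun n ↦ D n r := fun m n hmn x hx i ↦ hx (i.castLE hmn)
  have hlim : Filter.Tendsto (fun n ↦ γ.real (D n (a * s + b * t))) Filter.atTop
      (nhds (γ.real (⋂ n, D n (a * s + b * t)))) :=
    (ENNReal.tendsto_toReal (measure_ne_top _ _)).comp
      (tendsto_measure_iInter_atTop (fun n ↦ (hD n _).nullMeasurableSet) (hanti _)
        ⟨0, measure_ne_top _ _⟩)
  have hle : γ.real (s • C) ^ a * γ.real (t • C) ^ b ≤ γ.real (⋂ n, D n (a * s + b * t)) :=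
    ge_of_tendsto' hlim fun n ↦ calc
      _ ≤ γ.real (D n s) ^ a * γ.real (D n t) ^ b := by
        gcongr
        exacts [measure_ne_top _ _, hsub hs n, measure_ne_top _ _, hsub ht n]
      _ ≤ _ := measureReal_polyhedron_logConcave hγ _ _ ha hb hab s t
  refine hle.trans (measureReal_mono fun x hx ↦ ?_)
  rw [Set.mem_iInter] at hx
  have hxc : (a * s + b * t)⁻¹ • x ∈ closure C := by
    rw [← hlc, Set.mem_iInter]
    intro n
    have := hx (n + 1) (Fin.last n)
    rw [Fin.val_last] at this
    simpa [inv_mul_le_iff₀ hr] using this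
  have := hC.combo_closure_interior_mem_interior hxc (hCo.interior_eq.symm ▸ h0) hr.le
    (sub_pos.2 hst) (by ring)
  rw [hCo.interior_eq, smul_inv_smul₀ hr.ne', smul_zero, add_zero] at this
  exact this

end Banach

/-- Let `X` be a separable Banach space, `γ` a nondegenerate centered
Gaussian measure on `X`, and `C ⊆ X` an open convex set with `0 ∈ C`. Then there exists
`M > 0` such that `γ((1+η)C) − γ(C) ≤ M·η` for every `η ∈ (0,1)`. -/
theorem gaussian_measure_dilation_bound
    {X : Type*} [NormedAddCommGroup X] [NormedSpace ℝ X] [CompleteSpace X]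
    [SecondCountableTopology X] [MeasurableSpace X] [BorelSpace X]
    (γ : Measure X) [IsProbabilityMeasure γ]
    (hγ : ∀ ℓ : X →L[ℝ] ℝ, ∃ v : ℝ≥0, γ.map ℓ = gaussianReal 0 v)
    (hnd : ∀ ℓ : X →L[ℝ] ℝ, ℓ ≠ 0 → ∀ c : ℝ, γ.map ℓ ≠ Measure.dirac c)
    (C : Set X) (hC : Convex ℝ C) (hCo : IsOpen C) (h0 : (0 : X) ∈ C) :
    ∃ M : ℝ, 0 < M ∧ ∀ η : ℝ, η ∈ Set.Ioo (0 : ℝ) 1 →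
      (γ ((1 + η) • C)).toReal - (γ C).toReal ≤ M * η := by
  have hG : IsGaussian γ := isGaussian_of_map_eq_gaussianReal fun ℓ ↦ ⟨0, hγ ℓ⟩
  have hmean : ∫ x, x ∂γ = 0 := by
    refine SeparatingDual.eq_zero_of_forall_dual_eq_zero (R := ℝ) fun ℓ ↦ ?_
    obtain ⟨v, hv⟩ := hγ ℓ
    have := integral_map (μ := γ) (φ := ℓ) (by fun_prop) (f := fun x ↦ x) (by fun_prop)
    rw [hv, integral_id_gaussianReal] at this
    rw [← IsGaussian.integral_dual, this]
  have hpos : 0 < γ.real ((1 / 2 : ℝ) • C) := by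
    have hopen : IsOpen ((1 / 2 : ℝ) • C) := hCo.smul₀ (by norm_num)
    obtain ⟨r, hr, hrC⟩ := Metric.isOpen_iff.1 hopen 0 ⟨0, h0, smul_zero _⟩
    exact ENNReal.toReal_pos ((measure_ball_zero_pos_of_isGaussian hmean hr).trans_le
      (measure_mono hrC)).ne' (measure_ne_top _ _)
  set p := γ.real ((1 / 2 : ℝ) • C) with hp
  have hlog : Real.log p ≤ 0 := Real.log_nonpos hpos.le measureReal_le_one
  refine ⟨-2 * Real.log p + 1, by linarith, fun η hη ↦ ?_⟩
  set q := γ.real ((1 + η) • C) with hq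
  change q - γ.real C ≤ _
  have hq0 : 0 ≤ q := measureReal_nonneg
  have hq1 : q ≤ 1 := measureReal_le_one
  have key (a : ℝ) (ha : η / (1 / 2 + η) < a) (ha1 : a < 1) :
      q - γ.real C ≤ -a * Real.log p := by
    have ha0 : 0 < a := (div_pos hη.1 (by linarith [hη.1])).trans ha
    rw [div_lt_iff₀ (by linarith [hη.1])] at ha
    have h := measureReal_dilate_logConcave hmean hC hCo h0 (s := 1 / 2) (t := 1 + η) ha0
      (sub_pos.2 ha1) (by ring) (by norm_num) (by linarith [hη.1]) (by linarith)
    rw [← hp, ← hq] at h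
    have h1 : q ≤ q ^ (1 - a) := by
      simpa using Real.rpow_le_rpow_of_exponent_ge' hq0 hq1 (sub_pos.2 ha1).le
        (show 1 - a ≤ 1 by linarith)
    have h2 : a * Real.log p + 1 ≤ p ^ a := by
      rw [Real.rpow_def_of_pos hpos, mul_comm]
      exact Real.add_one_le_exp _
    have h3 : p ^ a ≤ 1 := Real.rpow_le_one hpos.le measureReal_le_one ha0.le
    have h4 : p ^ a * q ≤ γ.real C :=
      (mul_le_mul_of_nonneg_left h1 (Real.rpow_nonneg hpos.le a)).trans h
    nlinarith
  have hη1 : η / (1 / 2 + η) < 1 := (div_lt_one (by linarith [hη.1])).2 (by linarith)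
  have hη2 : η / (1 / 2 + η) ≤ 2 * η := by
    rw [div_le_iff₀ (by linarith [hη.1])]
    nlinarith [hη.1]
  have hle : q - γ.real C ≤ -(η / (1 / 2 + η)) * Real.log p := by
    refine ge_of_tendsto (f := fun a : ℝ ↦ -a * Real.log p)
      (x := nhdsWithin (η / (1 / 2 + η)) (Set.Ioi (η / (1 / 2 + η)))) ?_ ?_
    · exact (Continuous.tendsto (by fun_prop) _).mono_left nhdsWithin_le_nhds
    · filter_upwards [Ioo_mem_nhdsGT hη1] with a ha using key a ha.1 ha.2
  nlinarith [hη.1]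
end

section
/- Let X be an infinite-dimensional separable Hilbert space, γ a nondegenerate centered Gaussian measure on X, and Q the covariance operator of γ. Then for every x₀ ∈ X and every p ∈ [1,∞), the function x ↦ ⟨Q(x−x₀), x−x₀⟩^{−p/2} belongs to L¹(X,γ), i.e. ∫_X ⟨Q(x−x₀), x−x₀⟩^{−p/2} dγ(x) < ∞. -/
open MeasureTheory ProbabilityTheory
open scoped ENNReal NNReal RealInnerProductSpace

lemma integrableOn_abs_rpow_neg {q : ℝ} (hq : q < 1) :
    IntegrableOn (fun t : ℝ => |t| ^ (-q)) (Set.Ioc (-1) 1) := by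
  have h : IntervalIntegrable (fun t : ℝ => |t| ^ (-q)) volume 0 1 :=
    (intervalIntegral.intervalIntegrable_rpow' (r := -q) (by linarith)).congr fun t ht => by
      rw [Set.uIoc_of_le zero_le_one] at ht
      simp only [abs_of_pos ht.1]
  have h' : IntervalIntegrable (fun t : ℝ => |t| ^ (-q)) volume (-1) 0 := by
    simpa using (h.comp_sub_left 0).symm
  exact (intervalIntegrable_iff_integrableOn_Ioc_of_le (by norm_num)).1 (h'.trans h)

lemma gaussianReal_le_smul_volume (m : ℝ) {v : ℝ≥0} (hv : v ≠ 0) :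
    gaussianReal m v ≤ ENNReal.ofReal (√(2 * Real.pi * v))⁻¹ • volume := by
  rw [gaussianReal_of_var_ne_zero m hv, ← withDensity_const]
  refine withDensity_mono (ae_of_all _ fun x => ENNReal.ofReal_le_ofReal ?_)
  refine mul_le_of_le_one_right (by positivity) (Real.exp_le_one_iff.2 ?_)
  rw [neg_div]
  exact neg_nonpos.2 (by positivity)

/-- Negative moments of order `q < 1` of a nondegenerate real Gaussian are finite. -/
lemma integrable_abs_sub_rpow_neg_gaussianReal (m : ℝ) {v : ℝ≥0} (hv : v ≠ 0) (a : ℝ) {q : ℝ}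
    (hq₀ : 0 ≤ q) (hq : q < 1) :
    Integrable (fun t : ℝ => |t - a| ^ (-q)) (gaussianReal m v) := by
  set g : ℝ → ℝ := (Set.Ioc (-1) 1).indicator fun t : ℝ => |t| ^ (-q)
  have hg : Integrable (fun t => g (t - a)) (gaussianReal m v) :=
    ((((integrable_indicator_iff measurableSet_Ioc).2
      (integrableOn_abs_rpow_neg hq)).comp_sub_right a).smul_measure
        ENNReal.ofReal_ne_top).mono_measure (gaussianReal_le_smul_volume m hv)
  refine ((integrable_const (1 : ℝ)).add hg).mono'
    (by fun_prop : Measurable fun t : ℝ => |t - a| ^ (-q)).aestronglyMeasurable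
    (ae_of_all _ fun t => ?_)
  rw [Real.norm_of_nonneg (by positivity)]
  by_cases ht : t - a ∈ Set.Ioc (-1 : ℝ) 1
  · simp [g, Set.indicator_of_mem ht]
  · have h1 : 1 ≤ |t - a| := by
      by_contra! h
      exact ht ⟨(abs_lt.1 h).1, (abs_lt.1 h).2.le⟩
    simpa [g, Set.indicator_of_notMem ht] using
      Real.rpow_le_one_of_one_le_of_nonpos h1 (neg_nonpos.2 hq₀)

lemma ProbabilityTheory.iIndepFun.integrable_prod {Ω ι : Type*} [MeasurableSpace Ω] [Fintype ι]
    {μ : Measure Ω} {Y : ι → Ω → ℝ} (hY : iIndepFun Y μ) (hm : ∀ i, Measurable (Y i))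
    (hint : ∀ i, Integrable (Y i) μ) : Integrable (fun ω => ∏ i, Y i ω) μ := by
  refine ⟨(Finset.measurable_prod _ fun i _ => hm i).aestronglyMeasurable, ?_⟩
  have h := lintegral_prod_eq_prod_lintegral_of_indepFun Finset.univ (fun i ω => ‖Y i ω‖ₑ)
    (hY.comp (fun _ => fun t => ‖t‖ₑ) fun _ => measurable_enorm) fun i => (hm i).enorm
  have hnorm (ω : Ω) : ‖∏ i, Y i ω‖ₑ = ∏ i, ‖Y i ω‖ₑ := by
    simp only [enorm_eq_nnnorm, nnnorm_prod, ENNReal.ofNNReal_finsetProd]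
  simp only [HasFiniteIntegral, hnorm]
  rw [h]
  exact ENNReal.prod_lt_top fun i _ => (hint i).2

/-- An infinite-dimensional space contains a sequence of nonzero vectors which is orthogonal for
a given symmetric continuous bilinear form. -/
lemma exists_seq_ne_zero_inner_clm_eq_zero {X : Type*} [NormedAddCommGroup X]
    [InnerProductSpace ℝ X] (hinf : ¬ FiniteDimensional ℝ X) (T : X →L[ℝ] X)
    (hT : ∀ u v, ⟪T u, v⟫ = ⟪T v, u⟫) :
    ∃ w : ℕ → X, (∀ n, w n ≠ 0) ∧ Pairwise fun m n => ⟪T (w m), w n⟫ = 0 := by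
  have : Std.Symm fun u v : X => ⟪T u, v⟫ = 0 := ⟨fun u v h => by rw [hT, h]⟩
  refine exists_seq_of_forall_finset_exists' (fun u : X => u ≠ 0) (fun u v => ⟪T u, v⟫ = 0)
    fun s _ => ?_
  set K : Submodule ℝ X := Submodule.span ℝ (T '' s)
  have : FiniteDimensional ℝ K := FiniteDimensional.span_of_finite ℝ (s.finite_toSet.image T)
  have hK : Kᗮ ≠ ⊥ := fun h => hinf <| by
    rw [Submodule.orthogonal_eq_bot_iff] at h
    rw [h] at this
    exact Submodule.topEquiv.finiteDimensional
  obtain ⟨y, hyK, hy⟩ := Submodule.exists_mem_ne_zero_of_ne_bot hK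
  exact ⟨y, hy, fun x hx => (Submodule.mem_orthogonal K y).1 hyK _
    (Submodule.subset_span ⟨x, hx, rfl⟩)⟩

lemma inner_clm_sq_le_mul {X : Type*} [NormedAddCommGroup X] [InnerProductSpace ℝ X]
    (Q : X →L[ℝ] X) (hsymm : ∀ u v, ⟪Q u, v⟫ = ⟪Q v, u⟫) (hnonneg : ∀ u, 0 ≤ ⟪Q u, u⟫) (y w : X) :
    ⟪Q w, y⟫ ^ 2 ≤ ⟪Q w, w⟫ * ⟪Q y, y⟫ := by
  have h : discrim ⟪Q w, w⟫ (2 * ⟪Q w, y⟫) ⟪Q y, y⟫ ≤ 0 := discrim_le_zero fun t => by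
    have := hnonneg (t • w + y)
    simp only [map_add, map_smul, inner_add_left, inner_add_right, inner_smul_left,
      inner_smul_right, hsymm y w, RCLike.conj_to_real] at this
    linarith
  rw [discrim] at h
  linarith

/-- Let `X` be an infinite-dimensional separable Hilbert space, `γ` a
nondegenerate centered Gaussian measure on `X`, and `Q` the covariance operator of `γ`,
i.e. the bounded operator with `⟪Qu, v⟫ = ∫ ⟪x,u⟫⟪x,v⟫ dγ(x)`. Then for every `x₀ ∈ X`
and every `p ∈ [1,∞)`, the function `x ↦ ⟪Q(x−x₀), x−x₀⟫^{−p/2}` belongs to `L¹(X,γ)`. -/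
theorem covariance_quadratic_form_neg_power_integrable
    {X : Type*} [NormedAddCommGroup X] [InnerProductSpace ℝ X] [CompleteSpace X]
    [SecondCountableTopology X] [MeasurableSpace X] [BorelSpace X]
    (hinf : ¬ FiniteDimensional ℝ X)
    (γ : Measure X) [IsProbabilityMeasure γ]
    (hγ : ∀ ℓ : X →L[ℝ] ℝ, ∃ v : ℝ≥0, γ.map ℓ = gaussianReal 0 v)
    (hnd : ∀ ℓ : X →L[ℝ] ℝ, ℓ ≠ 0 → ∀ c : ℝ, γ.map ℓ ≠ Measure.dirac c)
    (Q : X →L[ℝ] X)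
    (hQ : ∀ u v : X, ⟪Q u, v⟫ = ∫ x, ⟪x, u⟫ * ⟪x, v⟫ ∂γ)
    (x₀ : X) (p : ℝ) (hp : 1 ≤ p) :
    Integrable (fun x => ⟪Q (x - x₀), x - x₀⟫ ^ (-(p / 2))) γ := by
  have hG : IsGaussian γ := isGaussian_of_map_eq_gaussianReal fun L => ⟨0, hγ L⟩
  have hmem (u : X) : MemLp (fun x => ⟪x, u⟫) 2 γ := by
    simpa [real_inner_comm] using IsGaussian.memLp_dual γ (innerSL ℝ u) 2 (by simp)
  have hsymm (u v : X) : ⟪Q u, v⟫ = ⟪Q v, u⟫ := by simp only [hQ, mul_comm]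
  have hnonneg (u : X) : 0 ≤ ⟪Q u, u⟫ := by
    rw [hQ]
    exact integral_nonneg fun x => mul_self_nonneg _
  have hvar (u : X) (hu : u ≠ 0) : ∃ v : ℝ≥0, v ≠ 0 ∧
      γ.map (fun x => ⟪x, u⟫) = gaussianReal 0 v := by
    obtain ⟨v, hv⟩ := hγ (innerSL ℝ u)
    refine ⟨v, ?_, by simpa [real_inner_comm, Function.comp_def] using hv⟩
    rintro rfl
    refine hnd (innerSL ℝ u) (fun h => hu ?_) 0 (by simpa using hv)
    simpa using DFunLike.congr_fun h u
  have hpos (u : X) (hu : u ≠ 0) : 0 < ⟪Q u, u⟫ := by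
    refine (hnonneg u).lt_of_ne' fun h => ?_
    rw [hQ, integral_eq_zero_iff_of_nonneg (fun x => mul_self_nonneg _)
      ((hmem u).integrable_mul (hmem u))] at h
    obtain ⟨v, hv, hmap⟩ := hvar u hu
    have := nullSingletonClass_gaussianReal (μ := 0) hv
    have h0 : ∀ᵐ t ∂(γ.map fun x => ⟪x, u⟫), t ≠ 0 := by
      rw [hmap]; exact Measure.ae_ne _ 0
    have h0' := ae_of_ae_map (by fun_prop) h0
    obtain ⟨x, hx, hx'⟩ := (h.and h0').exists
    exact hx' (mul_self_eq_zero.1 hx)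
  have hmean (u : X) : ∫ x, ⟪x, u⟫ ∂γ = 0 := by
    obtain ⟨v, hv⟩ := hγ (innerSL ℝ u)
    have h := integral_map (μ := γ) (φ := innerSL ℝ u) (by fun_prop) (f := fun t : ℝ => t)
      (by fun_prop)
    rw [hv, integral_id_gaussianReal] at h
    simpa [real_inner_comm] using h.symm
  obtain ⟨w, hw, hwo⟩ := exists_seq_ne_zero_inner_clm_eq_zero hinf (Q ∘L Q ∘L Q)
    fun u v => by
      simp only [ContinuousLinearMap.comp_apply]
      rw [hsymm, real_inner_comm, hsymm, real_inner_comm, hsymm]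
  have hQw (i : ℕ) : Q (w i) ≠ 0 := fun h => by
    simpa [h] using hpos _ (hw i)
  obtain ⟨n, hn⟩ := exists_nat_gt p
  have hn₀ : (0 : ℝ) < n := by linarith
  set q : ℝ := p / n
  have hq₀ : 0 ≤ q := by positivity
  have hq : q < 1 := (div_lt_one hn₀).2 hn
  set u : Fin n → X := fun i => Q (w i)
  have hind : iIndepFun (fun (i : Fin n) x => ⟪x, u i⟫) γ := by
    refine HasGaussianLaw.iIndepFun_of_covariance_eq_zero ?_ fun i j hij => ?_
    · simpa [real_inner_comm] using IsGaussian.hasGaussianLaw_id.map_fun (P := γ)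
        (ContinuousLinearMap.pi fun i => innerSL ℝ (u i))
    · rw [covariance_eq_sub (hmem _) (hmem _), hmean, zero_mul, sub_zero]
      change ∫ x, ⟪x, u i⟫ * ⟪x, u j⟫ ∂γ = 0
      rw [← hQ, real_inner_comm, hsymm]
      exact hwo (Fin.val_injective.ne hij)
  set s : Fin n → ℝ := fun i => ⟪Q (w i), w i⟫
  set a : Fin n → ℝ := fun i => ⟪x₀, u i⟫
  set g : Fin n → ℝ → ℝ := fun i t => |t - a i| ^ (-q) * (s i) ^ (q / 2)
  have hgm (i : Fin n) : Measurable (g i) := by fun_prop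
  have hprod : Integrable (fun x => ∏ i, g i ⟪x, u i⟫) γ := by
    refine (hind.comp g hgm).integrable_prod (fun i => (hgm i).comp (by fun_prop)) fun i => ?_
    obtain ⟨v, hv, hmap⟩ := hvar (u i) (hQw i)
    refine Integrable.comp_measurable ?_ (by fun_prop)
    rw [hmap]
    exact (integrable_abs_sub_rpow_neg_gaussianReal 0 hv (a i) hq₀ hq).mul_const _
  have hne : ∀ᵐ x ∂γ, ∀ i, ⟪x, u i⟫ ≠ a i := ae_all_iff.2 fun i => by
    obtain ⟨v, hv, hmap⟩ := hvar (u i) (hQw i)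
    have := nullSingletonClass_gaussianReal (μ := 0) hv
    refine ae_of_ae_map (p := fun t => t ≠ a i) (by fun_prop) ?_
    rw [hmap]; exact Measure.ae_ne _ _
  have hmeas : Measurable fun x => ⟪Q (x - x₀), x - x₀⟫ ^ (-(p / 2)) :=
    (by fun_prop : Measurable fun x => ⟪Q (x - x₀), x - x₀⟫).pow_const _
  refine hprod.mono' hmeas.aestronglyMeasurable (hne.mono fun x hx => ?_)
  set A : ℝ := ⟪Q (x - x₀), x - x₀⟫
  have hA : 0 ≤ A := hnonneg _
  have hApow : A ^ (-(p / 2)) = ∏ _i : Fin n, A ^ (-(q / 2)) := by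
    rw [Finset.prod_const, Finset.card_univ, Fintype.card_fin, ← Real.rpow_mul_natCast hA]
    congr 1
    simp only [q]
    field_simp
  rw [Real.norm_of_nonneg (by positivity), hApow]
  refine Finset.prod_le_prod (fun i _ => by positivity) fun i _ => ?_
  have hs : 0 < s i := hpos _ (hw i)
  have ht : 0 < |⟪x, u i⟫ - a i| := abs_pos.2 (sub_ne_zero.2 (hx i))
  have hle : |⟪x, u i⟫ - a i| ^ 2 / s i ≤ A := by
    rw [div_le_iff₀ hs, sq_abs, mul_comm]
    have h := inner_clm_sq_le_mul Q hsymm hnonneg (x - x₀) (w i)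
    rwa [real_inner_comm, inner_sub_left] at h
  refine (Real.rpow_le_rpow_of_nonpos (by positivity) hle (by linarith)).trans_eq ?_
  rw [Real.div_rpow (by positivity) hs.le, ← Real.rpow_natCast_mul ht.le, Real.rpow_neg hs.le,
    div_inv_eq_mul]
  congr 2
  push_cast
  ring
end

section
/- Let u ∈ L¹(γ_n) have finite Gaussian total variation V_γ(u) < ∞, and let z : ℝ^n → ℝ^n be an admissible vector field (C¹, bounded, with bounded derivative, ‖z(x)‖ ≤ 1 for all x) such that V_γ(u) = ∫ u · div_γ z dγ_n. Then for every r ∈ ℝ the sublevel set {u < r} satisfies P_γ({u < r}) = −∫_{{u<r}} div_γ z dγ_n; in particular P_γ({u < r}) ≤ ∫ |div_γ z| dγ_n for every r ∈ ℝ. -/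
open MeasureTheory Real Filter
open scoped RealInnerProductSpace ENNReal

/-- The standard Gaussian measure `γ_n` on `ℝ^n`, with density
`(2π)^{-n/2} exp(-‖x‖²/2)` with respect to Lebesgue measure. -/
noncomputable def gaussianMeasure (n : ℕ) : Measure (EuclideanSpace ℝ (Fin n)) :=
  (volume : Measure (EuclideanSpace ℝ (Fin n))).withDensity fun x =>
    ENNReal.ofReal ((2 * π) ^ (-(n : ℝ) / 2) * Real.exp (-‖x‖ ^ 2 / 2))

/-- The Gaussian divergence `div_γ φ(x) = div φ(x) − ⟨x, φ(x)⟩` of a vector field. -/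
noncomputable def gdiv (n : ℕ) (φ : EuclideanSpace ℝ (Fin n) → EuclideanSpace ℝ (Fin n))
    (x : EuclideanSpace ℝ (Fin n)) : ℝ :=
  (∑ i : Fin n, fderiv ℝ φ x (EuclideanSpace.single i 1) i) - ⟪x, φ x⟫

/-- A vector field is admissible if it is `C¹`, bounded with bounded derivative,
and satisfies `‖φ(x)‖ ≤ 1` for all `x`. -/
def Admissible (n : ℕ) (φ : EuclideanSpace ℝ (Fin n) → EuclideanSpace ℝ (Fin n)) : Prop :=
  ContDiff ℝ 1 φ ∧ (∃ M, ∀ x, ‖fderiv ℝ φ x‖ ≤ M) ∧ ∀ x, ‖φ x‖ ≤ 1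

/-- The Gaussian total variation `V_γ(u) = sup {∫ u · div_γ φ dγ_n : φ admissible}`. -/
noncomputable def totVar (n : ℕ) (u : EuclideanSpace ℝ (Fin n) → ℝ) : ℝ≥0∞ :=
  ⨆ (φ : EuclideanSpace ℝ (Fin n) → EuclideanSpace ℝ (Fin n)) (_ : Admissible n φ),
    ENNReal.ofReal (∫ x, u x * gdiv n φ x ∂(gaussianMeasure n))

/-- The Gaussian perimeter `P_γ(E) = V_γ(χ_E)` of a set `E ⊆ ℝⁿ`. -/
noncomputable def gPerimeter (n : ℕ) (E : Set (EuclideanSpace ℝ (Fin n))) : ℝ≥0∞ :=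
  totVar n (E.indicator fun _ => 1)

section GaussianVariation

open scoped Topology ContDiff Convolution

variable {n : ℕ}

local notation "𝔼" => EuclideanSpace ℝ (Fin n)

/-- The density of the standard Gaussian measure with respect to Lebesgue measure. -/
noncomputable def gaussianWeight (n : ℕ) (x : EuclideanSpace ℝ (Fin n)) : ℝ :=
  (2 * π) ^ (-(n : ℝ) / 2) * Real.exp (-‖x‖ ^ 2 / 2)

/-- The trace, as a continuous linear functional on endomorphisms of `ℝⁿ`. -/
noncomputable def traceFunctional (n : ℕ) :
    (EuclideanSpace ℝ (Fin n) →L[ℝ] EuclideanSpace ℝ (Fin n)) →L[ℝ] ℝ :=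
  ∑ i : Fin n, (EuclideanSpace.proj i : EuclideanSpace ℝ (Fin n) →L[ℝ] ℝ).comp
    (ContinuousLinearMap.apply ℝ (EuclideanSpace ℝ (Fin n)) (EuclideanSpace.single i (1 : ℝ)))

/-- The divergence of a vector field. -/
noncomputable def divergence (n : ℕ) (φ : EuclideanSpace ℝ (Fin n) → EuclideanSpace ℝ (Fin n))
    (x : EuclideanSpace ℝ (Fin n)) : ℝ :=
  traceFunctional n (fderiv ℝ φ x)

theorem traceFunctional_apply (A : 𝔼 →L[ℝ] 𝔼) :
    traceFunctional n A = ∑ i : Fin n, A (EuclideanSpace.single i 1) i := by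
  simp [traceFunctional]

theorem gdiv_eq (φ : 𝔼 → 𝔼) (x : 𝔼) : gdiv n φ x = divergence n φ x - ⟪x, φ x⟫ := by
  simp [gdiv, divergence, traceFunctional_apply]

theorem traceFunctional_smulRight (L : 𝔼 →L[ℝ] ℝ) (v : 𝔼) :
    traceFunctional n (L.smulRight v) = L v := by
  have h : v = ∑ i, v i • EuclideanSpace.single i (1 : ℝ) := by
    ext j
    simp [Finset.sum_apply, Pi.single_apply]
  conv_rhs => rw [h, map_sum]
  simp [traceFunctional_apply, mul_comm]

theorem divergence_smul {a : 𝔼 → ℝ} {φ : 𝔼 → 𝔼} {x : 𝔼} (ha : DifferentiableAt ℝ a x)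
    (hφ : DifferentiableAt ℝ φ x) :
    divergence n (fun y => a y • φ y) x = a x * divergence n φ x + fderiv ℝ a x (φ x) := by
  unfold divergence
  rw [fderiv_fun_smul ha hφ, map_add, map_smul, traceFunctional_smulRight, smul_eq_mul]

theorem divergence_add {φ ψ : 𝔼 → 𝔼} {x : 𝔼} (hφ : DifferentiableAt ℝ φ x)
    (hψ : DifferentiableAt ℝ ψ x) :
    divergence n (fun y => φ y + ψ y) x = divergence n φ x + divergence n ψ x := by
  unfold divergence
  rw [fderiv_fun_add hφ hψ, map_add]

theorem continuous_divergence {φ : 𝔼 → 𝔼} (hφ : ContDiff ℝ 1 φ) :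
    Continuous (divergence n φ) :=
  (traceFunctional n).continuous.comp (hφ.continuous_fderiv one_ne_zero)

theorem continuous_gdiv {φ : 𝔼 → 𝔼} (hφ : ContDiff ℝ 1 φ) : Continuous (gdiv n φ) := by
  have : gdiv n φ = fun x => divergence n φ x - ⟪x, φ x⟫ := funext (gdiv_eq φ)
  rw [this]
  have := hφ.continuous
  have := continuous_divergence hφ
  fun_prop

theorem hasCompactSupport_divergence {φ : 𝔼 → 𝔼} (hφ : HasCompactSupport φ) :
    HasCompactSupport (divergence n φ) :=
  (hφ.fderiv ℝ).comp_left (map_zero (traceFunctional n))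

theorem gaussianWeight_pos (x : 𝔼) : 0 < gaussianWeight n x := by
  unfold gaussianWeight
  positivity

theorem contDiff_gaussianWeight : ContDiff ℝ ∞ (gaussianWeight n) := by
  unfold gaussianWeight
  have : ContDiff ℝ ∞ (fun x : 𝔼 => ‖x‖ ^ 2) := contDiff_norm_sq ℝ
  fun_prop

theorem continuous_gaussianWeight : Continuous (gaussianWeight n) :=
  contDiff_gaussianWeight.continuous

theorem fderiv_gaussianWeight (x v : 𝔼) :
    fderiv ℝ (gaussianWeight n) x v = -(gaussianWeight n x * ⟪x, v⟫) := by
  have h1 : HasFDerivAt (fun x : 𝔼 => ‖x‖ ^ 2) _ x := (hasStrictFDerivAt_norm_sq x).hasFDerivAt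
  have h2 := ((h1.neg.mul_const (1 / 2)).exp).const_mul ((2 * π) ^ (-(n : ℝ) / 2))
  have h3 : gaussianWeight n = fun y : 𝔼 => (2 * π) ^ (-(n : ℝ) / 2) *
      Real.exp (-‖y‖ ^ 2 * (1 / 2)) := by
    ext y
    simp only [gaussianWeight, neg_mul]
    ring_nf
  rw [h3]
  erw [h2.fderiv]
  simp
  ring

theorem gaussianWeight_mul_gdiv {φ : 𝔼 → 𝔼} {x : 𝔼} (hφ : DifferentiableAt ℝ φ x) :
    gaussianWeight n x * gdiv n φ x = divergence n (fun y => gaussianWeight n y • φ y) x := by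
  rw [divergence_smul (contDiff_gaussianWeight.differentiable (by simp) x) hφ,
    fderiv_gaussianWeight, gdiv_eq]
  ring

theorem measurable_ofReal_gaussianWeight :
    Measurable fun x : 𝔼 => ENNReal.ofReal (gaussianWeight n x) :=
  continuous_gaussianWeight.measurable.ennreal_ofReal

theorem integral_gaussianMeasure (f : 𝔼 → ℝ) :
    ∫ x, f x ∂(gaussianMeasure n) = ∫ x, gaussianWeight n x * f x := by
  have := integral_withDensity_eq_integral_toReal_smul
    (μ := (volume : Measure 𝔼)) measurable_ofReal_gaussianWeight
    (Eventually.of_forall fun _ => ENNReal.ofReal_lt_top) f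
  simp only [ENNReal.toReal_ofReal (gaussianWeight_pos _).le, smul_eq_mul] at this
  exact this

theorem integrable_gaussianMeasure_iff (f : 𝔼 → ℝ) :
    Integrable f (gaussianMeasure n) ↔ Integrable fun x => gaussianWeight n x * f x := by
  have := integrable_withDensity_iff_integrable_smul'
    (μ := (volume : Measure 𝔼)) measurable_ofReal_gaussianWeight
    (Eventually.of_forall fun _ => ENNReal.ofReal_lt_top) (g := f)
  simp only [ENNReal.toReal_ofReal (gaussianWeight_pos _).le, smul_eq_mul] at this
  exact this

theorem gaussianMeasure_absolutelyContinuous :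
    gaussianMeasure n ≪ (volume : Measure 𝔼) :=
  withDensity_absolutelyContinuous _ _

theorem Continuous.integrable_gaussianMeasure {f : 𝔼 → ℝ} (hf : Continuous f)
    (hc : HasCompactSupport f) : Integrable f (gaussianMeasure n) := by
  rw [integrable_gaussianMeasure_iff]
  exact (continuous_gaussianWeight.mul hf).integrable_of_hasCompactSupport hc.mul_left

theorem locallyIntegrable_of_gaussianMeasure {u : 𝔼 → ℝ} (hu : Integrable u (gaussianMeasure n)) :
    LocallyIntegrable u := by
  rw [integrable_gaussianMeasure_iff] at hu
  have h := hu.locallyIntegrable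
  rw [← locallyIntegrableOn_univ] at h ⊢
  have := h.continuousOn_mul (g := fun x => (gaussianWeight n x)⁻¹)
    (continuous_gaussianWeight.inv₀ fun x => (gaussianWeight_pos x).ne').continuousOn
    isOpen_univ.isLocallyClosed
  refine this.congr (Eventually.of_forall fun x => ?_)
  simp [(gaussianWeight_pos x).ne']

theorem integral_divergence_eq_zero {φ : 𝔼 → 𝔼} (hφ : ContDiff ℝ 1 φ)
    (hc : HasCompactSupport φ) : ∫ x, divergence n φ x = 0 := by
  have hd : ∀ x, DifferentiableAt ℝ φ x := hφ.differentiable one_ne_zero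
  have hcd := hφ.continuous_fderiv one_ne_zero
  have hInt : ∀ i : Fin n, Integrable fun x => fderiv ℝ φ x (EuclideanSpace.single i 1) i := by
    intro i
    refine Continuous.integrable_of_hasCompactSupport (by fun_prop) ?_
    exact (hc.fderiv ℝ).comp_left (g := fun A : 𝔼 →L[ℝ] 𝔼 => A (EuclideanSpace.single i 1) i) rfl
  simp only [divergence, traceFunctional_apply]
  rw [integral_finsetSum _ fun i _ => hInt i]
  refine Finset.sum_eq_zero fun i _ => ?_
  have hci : HasCompactSupport fun x => φ x i := hc.comp_left (g := fun v : 𝔼 => v i) rfl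
  have hφc := hφ.continuous
  have hfi : ∀ x, fderiv ℝ (fun y => φ y i) x (EuclideanSpace.single i 1) =
      fderiv ℝ φ x (EuclideanSpace.single i 1) i := by
    intro x
    have := ((EuclideanSpace.proj i : EuclideanSpace ℝ (Fin n) →L[ℝ] ℝ).hasFDerivAt.comp x
      (hd x).hasFDerivAt).fderiv
    exact congrArg (fun A : 𝔼 →L[ℝ] ℝ => A (EuclideanSpace.single i 1)) this
  have := integral_mul_fderiv_eq_neg_fderiv_mul_of_integrable (μ := (volume : Measure 𝔼))
    (f := fun _ => (1 : ℝ)) (g := fun x => φ x i) (v := EuclideanSpace.single i 1)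
    (by simp) (by simpa [hfi] using hInt i)
    (by
      simp only [one_mul]
      exact Continuous.integrable_of_hasCompactSupport (by fun_prop) hci)
    (fun x _ => by fun_prop)
    (fun x _ => ((EuclideanSpace.proj i : EuclideanSpace ℝ (Fin n) →L[ℝ] ℝ).hasFDerivAt.comp x
      (hd x).hasFDerivAt).differentiableAt)
  simpa [hfi] using this

theorem divergence_const_smul (c : ℝ) {φ : 𝔼 → 𝔼} {x : 𝔼} (hφ : DifferentiableAt ℝ φ x) :
    divergence n (fun y => c • φ y) x = c * divergence n φ x := by
  unfold divergence
  rw [fderiv_fun_const_smul hφ, map_smul, smul_eq_mul]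

/-- Mollification by a normalised bump function. -/
noncomputable def mollify {F : Type*} [NormedAddCommGroup F] [NormedSpace ℝ F]
    (η : ContDiffBump (0 : 𝔼)) (f : 𝔼 → F) : 𝔼 → F :=
  η.normed volume ⋆[ContinuousLinearMap.lsmul ℝ ℝ, volume] f

theorem contDiff_mollify {F : Type*} [NormedAddCommGroup F] [NormedSpace ℝ F] [CompleteSpace F]
    (η : ContDiffBump (0 : 𝔼)) {f : 𝔼 → F} (hf : LocallyIntegrable f) :
    ContDiff ℝ ∞ (mollify η f) :=
  η.hasCompactSupport_normed.contDiff_convolution_left _ η.contDiff_normed hf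

theorem divergence_mollify (η : ContDiffBump (0 : 𝔼)) {φ : 𝔼 → 𝔼} (hφ : ContDiff ℝ 1 φ)
    (hc : HasCompactSupport φ) (x : 𝔼) :
    divergence n (mollify η φ) x = mollify η (divergence n φ) x := by
  have hη : LocallyIntegrable (η.normed (volume : Measure 𝔼)) :=
    η.continuous_normed.locallyIntegrable
  have h1 := (hc.hasFDerivAt_convolution_right (ContinuousLinearMap.lsmul ℝ ℝ) hη hφ x).fderiv
  have h2 : ConvolutionExists (η.normed (volume : Measure 𝔼)) (fderiv ℝ φ)
      ((ContinuousLinearMap.lsmul ℝ ℝ).precompR 𝔼) volume :=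
    (hc.fderiv ℝ).convolutionExists_right _ hη (hφ.continuous_fderiv one_ne_zero)
  unfold divergence mollify
  rw [h1]
  simp only [convolution]
  rw [← (traceFunctional n).integral_comp_comm (h2 x)]
  refine integral_congr_ae (Eventually.of_forall fun t => ?_)
  have : ((ContinuousLinearMap.lsmul ℝ ℝ : ℝ →L[ℝ] 𝔼 →L[ℝ] 𝔼).precompR 𝔼
      (η.normed volume t)) (fderiv ℝ φ (x - t)) = η.normed volume t • fderiv ℝ φ (x - t) := by
    ext v
    simp [ContinuousLinearMap.precompR_apply]
  simp only [this, map_smul, ContinuousLinearMap.lsmul_apply]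

open scoped Pointwise in
theorem integral_mul_mollify (η : ContDiffBump (0 : 𝔼)) {u h : 𝔼 → ℝ} (hu : LocallyIntegrable u)
    (hh : Continuous h) (hc : HasCompactSupport h) :
    ∫ x, u x * mollify η h x = ∫ x, mollify η u x * h x := by
  have e1 : ∀ x, u x * mollify η h x = ∫ y, u x * (η.normed volume (x - y) * h y) := by
    intro x
    rw [integral_const_mul]
    simp only [mollify, convolution_eq_swap, ContinuousLinearMap.lsmul_apply, smul_eq_mul]
  have e2 : ∀ y, mollify η u y * h y = ∫ x, u x * (η.normed volume (x - y) * h y) := by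
    intro y
    simp only [mollify, convolution_eq_swap, ContinuousLinearMap.lsmul_apply, smul_eq_mul]
    rw [← integral_mul_const]
    refine integral_congr_ae (Eventually.of_forall fun x => ?_)
    have : η.normed volume (y - x) = η.normed volume (x - y) := by
      rw [← ContDiffBump.normed_neg, neg_sub]
    simp only [this]
    ring
  simp_rw [e1, e2]
  refine integral_integral_swap ?_
  set K := tsupport h + tsupport (η.normed (volume : Measure 𝔼)) with hK
  have hKc : IsCompact K := hc.isCompact.add η.hasCompactSupport_normed.isCompact
  have hηc := η.continuous_normed (μ := (volume : Measure 𝔼))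
  obtain ⟨C, hC⟩ := η.hasCompactSupport_normed.exists_bound_of_continuous hηc
  have hI : Integrable (fun p : 𝔼 × 𝔼 => K.indicator u p.1 * h p.2) (volume.prod volume) :=
    ((hu.integrableOn_isCompact hKc).integrable_indicator hKc.measurableSet).mul_prod
      (hh.integrable_of_hasCompactSupport hc)
  refine (hI.bdd_mul (c := C) (f := fun p : 𝔼 × 𝔼 => η.normed volume (p.1 - p.2))
    (by fun_prop) (Eventually.of_forall fun p => hC _)).congr
    (Eventually.of_forall fun p => ?_)
  obtain ⟨x, y⟩ := p
  simp only [Function.uncurry]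
  by_cases hx : x ∈ K
  · rw [Set.indicator_of_mem hx]
    ring
  · rw [Set.indicator_of_notMem hx]
    by_cases hy : h y = 0
    · simp [hy]
    by_cases hz : η.normed (volume : Measure 𝔼) (x - y) = 0
    · simp [hz]
    · refine absurd ?_ hx
      have := Set.add_mem_add (subset_tsupport _ (Function.mem_support.2 hy))
        (subset_tsupport _ (Function.mem_support.2 hz))
      simpa using this

theorem norm_mollify_le (η : ContDiffBump (0 : 𝔼)) {φ : 𝔼 → 𝔼} (hφ : Continuous φ) {x : 𝔼} {c : ℝ}
    (hc : 0 ≤ c) (h : ∀ y ∈ Metric.ball x η.rOut, ‖φ y‖ ≤ c) : ‖mollify η φ x‖ ≤ c := by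
  have := dist_convolution_le (μ := (volume : Measure 𝔼)) (x₀ := x) (z₀ := (0 : 𝔼)) hc
    η.support_normed_eq.subset η.nonneg_normed η.integral_normed hφ.aestronglyMeasurable
    (by simpa using h)
  simpa [mollify] using this

theorem gaussianWeight_le {x y : 𝔼} {R ε : ℝ} (hy : ‖y‖ ≤ R) (hxy : ‖x - y‖ ≤ ε) (hε : ε ≤ 1) :
    gaussianWeight n y ≤ Real.exp (ε * (2 * R + 1) / 2) * gaussianWeight n x := by
  unfold gaussianWeight
  rw [mul_left_comm, ← Real.exp_add]
  gcongr
  have h0 := norm_nonneg (x - y)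
  have h1 : ‖x‖ ≤ ‖y‖ + ‖x - y‖ := by
    have := norm_add_le y (x - y)
    simpa using this
  have h2 : ‖x‖ ^ 2 ≤ (‖y‖ + ‖x - y‖) ^ 2 := by gcongr
  have h3 : ‖x - y‖ * (2 * ‖y‖ + ‖x - y‖) ≤ ε * (2 * R + 1) := by
    have := norm_nonneg y
    gcongr
    · linarith
    · linarith
  nlinarith

/-- Mollifying `u` increases its Gaussian variation, tested against fields supported in a fixed
ball, only by a factor close to one. -/
theorem integral_mollify_mul_gdiv_le {u : 𝔼 → ℝ} (hu : Integrable u (gaussianMeasure n)) {V : ℝ}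
    (hV : ∀ φ : 𝔼 → 𝔼, ContDiff ℝ 1 φ → HasCompactSupport φ → (∀ x, ‖φ x‖ ≤ 1) →
      ∫ x, u x * gdiv n φ x ∂(gaussianMeasure n) ≤ V)
    {ψ : 𝔼 → 𝔼} (hψ : ContDiff ℝ 1 ψ) (hc : HasCompactSupport ψ) (hψ1 : ∀ x, ‖ψ x‖ ≤ 1)
    {R : ℝ} (hR : ∀ x, ψ x ≠ 0 → ‖x‖ ≤ R) (η : ContDiffBump (0 : 𝔼)) (hη : η.rOut ≤ 1) :
    ∫ x, mollify η u x * gdiv n ψ x ∂(gaussianMeasure n) ≤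
      Real.exp (η.rOut * (2 * R + 1) / 2) * V := by
  obtain ⟨C, hCdef⟩ : ∃ C, C = Real.exp (η.rOut * (2 * R + 1) / 2) := ⟨_, rfl⟩
  rw [← hCdef]
  have hC : 0 < C := hCdef ▸ Real.exp_pos _
  have hw := contDiff_gaussianWeight (n := n)
  have hw1 : ContDiff ℝ 1 (gaussianWeight n) := hw.of_le (by simp)
  obtain ⟨Y, hYdef⟩ : ∃ Y : 𝔼 → 𝔼, Y = fun x => gaussianWeight n x • ψ x := ⟨_, rfl⟩
  have hY : ContDiff ℝ 1 Y := by
    rw [hYdef]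
    exact hw1.smul hψ
  have hYc : HasCompactSupport Y := by
    rw [hYdef]
    exact hc.smul_left (f := gaussianWeight n)
  have hX : ContDiff ℝ 1 (mollify η Y) :=
    (contDiff_mollify η hY.continuous.locallyIntegrable).of_le (by simp)
  have hXc : HasCompactSupport (mollify η Y) :=
    HasCompactSupport.convolution _ η.hasCompactSupport_normed hYc
  obtain ⟨φ, hφdef⟩ : ∃ φ : 𝔼 → 𝔼, φ = fun x => (C * gaussianWeight n x)⁻¹ • mollify η Y x :=
    ⟨_, rfl⟩
  have hpos : ∀ x, 0 < C * gaussianWeight n x := fun x => mul_pos hC (gaussianWeight_pos x)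
  have hφ : ContDiff ℝ 1 φ := by
    rw [hφdef]
    exact ((contDiff_const.mul hw1).inv fun x => (hpos x).ne').smul hX
  have hφc : HasCompactSupport φ := by
    rw [hφdef]
    exact hXc.smul_left (f := fun x => (C * gaussianWeight n x)⁻¹)
  have hφ1 : ∀ x, ‖φ x‖ ≤ 1 := by
    intro x
    rw [hφdef, norm_smul, norm_inv, Real.norm_of_nonneg (hpos x).le, inv_mul_le_iff₀ (hpos x),
      mul_one]
    apply norm_mollify_le η hY.continuous (hpos x).le
    intro y hy
    by_cases h0 : ψ y = 0
    · simpa [hYdef, h0] using (hpos x).le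
    · rw [hYdef, norm_smul, Real.norm_of_nonneg (gaussianWeight_pos y).le]
      have hxy : ‖x - y‖ ≤ η.rOut := by
        rw [norm_sub_rev, ← dist_eq_norm]
        exact (Metric.mem_ball.1 hy).le
      calc gaussianWeight n y * ‖ψ y‖ ≤ gaussianWeight n y * 1 :=
            mul_le_mul_of_nonneg_left (hψ1 y) (gaussianWeight_pos y).le
        _ = gaussianWeight n y := mul_one _
        _ ≤ C * gaussianWeight n x := by
            rw [hCdef]
            exact gaussianWeight_le (hR y h0) hxy hη
  have key : ∫ x, mollify η u x * gdiv n ψ x ∂(gaussianMeasure n) =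
      C * ∫ x, u x * gdiv n φ x ∂(gaussianMeasure n) := by
    rw [integral_gaussianMeasure, integral_gaussianMeasure, ← integral_const_mul]
    have e1 : ∀ x, gaussianWeight n x * (mollify η u x * gdiv n ψ x) =
        mollify η u x * divergence n Y x := by
      intro x
      rw [hYdef, ← gaussianWeight_mul_gdiv (hψ.differentiable one_ne_zero x)]
      ring
    have e2 : ∀ x, C * (gaussianWeight n x * (u x * gdiv n φ x)) =
        u x * mollify η (divergence n Y) x := by
      intro x
      have : (fun y => gaussianWeight n y • φ y) = fun y => C⁻¹ • mollify η Y y := by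
        ext1 y
        rw [hφdef]
        simp only [smul_smul]
        congr 1
        have := (gaussianWeight_pos y).ne'
        field_simp
      have h := gaussianWeight_mul_gdiv (hφ.differentiable one_ne_zero x)
      rw [this, divergence_const_smul _ (hX.differentiable one_ne_zero x),
        divergence_mollify η hY hYc] at h
      calc C * (gaussianWeight n x * (u x * gdiv n φ x))
          = C * u x * (gaussianWeight n x * gdiv n φ x) := by ring
        _ = _ := by rw [h]; field_simp
    simp only [e1, e2]
    exact (integral_mul_mollify η (locallyIntegrable_of_gaussianMeasure hu)
      (continuous_divergence hY) (hasCompactSupport_divergence hYc)).symm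
  rw [key]
  exact mul_le_mul_of_nonneg_left (hV φ hφ hφc hφ1) hC.le

theorem hasCompactSupport_gdiv {φ : 𝔼 → 𝔼} (hφ : HasCompactSupport φ) :
    HasCompactSupport (gdiv n φ) := by
  refine HasCompactSupport.intro hφ.isCompact fun x hx => ?_
  rw [gdiv_eq, divergence, fderiv_of_notMem_tsupport (𝕜 := ℝ) hx,
    image_eq_zero_of_notMem_tsupport hx, map_zero, inner_zero_right, sub_zero]

theorem integral_mul_gdiv_deriv_smul {f : ℝ → ℝ} (hf : ContDiff ℝ 2 f) {v : 𝔼 → ℝ}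
    (hv : ContDiff ℝ 1 v) {φ : 𝔼 → 𝔼} (hφ : ContDiff ℝ 1 φ) (hc : HasCompactSupport φ) :
    ∫ x, v x * gdiv n (fun y => deriv f (v y) • φ y) x ∂(gaussianMeasure n) =
      ∫ x, f (v x) * gdiv n φ x ∂(gaussianMeasure n) := by
  have hf' : ContDiff ℝ 1 (deriv f) := hf.deriv' (n := 1)
  have hw : ContDiff ℝ 1 (gaussianWeight n) := contDiff_gaussianWeight.of_le (by simp)
  have hfv : ContDiff ℝ 1 fun x => f (v x) := (hf.of_le one_le_two).comp hv
  have ha : ContDiff ℝ 1 fun x => deriv f (v x) := hf'.comp hv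
  have hb : ContDiff ℝ 1 fun x => v x * deriv f (v x) - f (v x) := (hv.mul ha).sub hfv
  have hZ : ContDiff ℝ 1 fun x => gaussianWeight n x • φ x := hw.smul hφ
  have hZc : HasCompactSupport fun x => gaussianWeight n x • φ x :=
    hc.smul_left (f := gaussianWeight n)
  have haφ : ContDiff ℝ 1 fun x => deriv f (v x) • φ x := ha.smul hφ
  have hB : ContDiff ℝ 1
      fun x => (v x * deriv f (v x) - f (v x)) • (gaussianWeight n x • φ x) := hb.smul hZ
  have hBc : HasCompactSupport
      fun x => (v x * deriv f (v x) - f (v x)) • (gaussianWeight n x • φ x) :=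
    hZc.smul_left (f := fun x => v x * deriv f (v x) - f (v x))
  have d {a : 𝔼 → ℝ} (h : ContDiff ℝ 1 a) (x : 𝔼) : DifferentiableAt ℝ a x :=
    h.differentiable one_ne_zero x
  have D {a : 𝔼 → 𝔼} (h : ContDiff ℝ 1 a) (x : 𝔼) : DifferentiableAt ℝ a x :=
    h.differentiable one_ne_zero x
  have hfd : ∀ x, fderiv ℝ (fun x => f (v x)) x = deriv f (v x) • fderiv ℝ v x := fun x =>
    ((hf.differentiable two_ne_zero (v x)).hasDerivAt.comp_hasFDerivAt x
      (d hv x).hasFDerivAt).fderiv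
  have key : ∀ x, gaussianWeight n x * (v x * gdiv n (fun y => deriv f (v y) • φ y) x) =
      gaussianWeight n x * (f (v x) * gdiv n φ x) +
        divergence n (fun x => (v x * deriv f (v x) - f (v x)) • (gaussianWeight n x • φ x)) x := by
    intro x
    rw [mul_left_comm, gaussianWeight_mul_gdiv (D haφ x), mul_left_comm,
      gaussianWeight_mul_gdiv (D hφ x), divergence_smul (d hb x) (D hZ x)]
    have e : (fun y => gaussianWeight n y • deriv f (v y) • φ y) =
        fun y => deriv f (v y) • gaussianWeight n y • φ y := by
      ext1 y
      rw [smul_comm]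
    rw [e, divergence_smul (d ha x) (D hZ x), fderiv_fun_sub ((d hv x).fun_mul (d ha x)) (d hfv x),
      fderiv_fun_mul (d hv x) (d ha x), hfd]
    simp only [sub_apply, add_apply, smul_apply, smul_eq_mul]
    ring
  rw [integral_gaussianMeasure, integral_gaussianMeasure]
  simp only [key]
  have hwc := continuous_gaussianWeight (n := n)
  have hfvc := hfv.continuous
  have hg := continuous_gdiv hφ
  rw [integral_add, integral_divergence_eq_zero hB hBc, add_zero]
  · refine Continuous.integrable_of_hasCompactSupport (by fun_prop) ?_
    exact ((hasCompactSupport_gdiv hc).mul_left (f := fun x => f (v x))).mul_left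
      (f := gaussianWeight n)
  · exact (continuous_divergence hB).integrable_of_hasCompactSupport
      (hasCompactSupport_divergence hBc)

theorem gdiv_add {φ ψ : 𝔼 → 𝔼} {x : 𝔼} (hφ : DifferentiableAt ℝ φ x)
    (hψ : DifferentiableAt ℝ ψ x) :
    gdiv n (fun y => φ y + ψ y) x = gdiv n φ x + gdiv n ψ x := by
  rw [gdiv_eq, gdiv_eq, gdiv_eq, divergence_add hφ hψ, inner_add_right]
  ring

/-- Dominated convergence for a bounded continuous function of an almost everywhere convergent
sequence, tested against an integrable function. -/
theorem tendsto_integral_comp_mul {f : ℝ → ℝ} (hf : Continuous f) {M : ℝ} (hM : ∀ t, |f t| ≤ M)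
    {v : ℕ → 𝔼 → ℝ} {u h : 𝔼 → ℝ} (hv : ∀ k, Continuous (v k))
    (hvu : ∀ᵐ x, Tendsto (fun k => v k x) atTop (𝓝 (u x)))
    (hh : Integrable h (gaussianMeasure n)) :
    Tendsto (fun k => ∫ x, f (v k x) * h x ∂(gaussianMeasure n)) atTop
      (𝓝 (∫ x, f (u x) * h x ∂(gaussianMeasure n))) := by
  refine tendsto_integral_of_dominated_convergence (fun x => M * |h x|)
    (fun k => (hf.comp (hv k)).aestronglyMeasurable.mul hh.aestronglyMeasurable)
    (hh.abs.const_mul M) (fun k => Eventually.of_forall fun x => ?_) ?_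
  · rw [Real.norm_eq_abs, abs_mul]
    exact mul_le_mul_of_nonneg_right (hM _) (abs_nonneg _)
  · filter_upwards [gaussianMeasure_absolutelyContinuous.ae_le hvu] with x hx
    exact ((hf.tendsto _).comp hx).mul_const _

theorem integral_comp_mul_gdiv_add_le_of_hasCompactSupport {u : 𝔼 → ℝ}
    (hu : Integrable u (gaussianMeasure n)) {V : ℝ}
    (hV : ∀ φ : 𝔼 → 𝔼, ContDiff ℝ 1 φ → HasCompactSupport φ → (∀ x, ‖φ x‖ ≤ 1) →
      ∫ x, u x * gdiv n φ x ∂(gaussianMeasure n) ≤ V)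
    {f g : ℝ → ℝ} (hf : ContDiff ℝ 2 f) (hg : ContDiff ℝ 2 g) (hf0 : ∀ t, 0 ≤ deriv f t)
    (hg0 : ∀ t, 0 ≤ deriv g t) (hfg : ∀ t, deriv f t + deriv g t ≤ 1) {M : ℝ}
    (hfM : ∀ t, |f t| ≤ M) (hgM : ∀ t, |g t| ≤ M) {φ ψ : 𝔼 → 𝔼} (hφ : ContDiff ℝ 1 φ)
    (hψ : ContDiff ℝ 1 ψ) (hφc : HasCompactSupport φ) (hψc : HasCompactSupport ψ)
    (hφ1 : ∀ x, ‖φ x‖ ≤ 1) (hψ1 : ∀ x, ‖ψ x‖ ≤ 1) :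
    ∫ x, f (u x) * gdiv n φ x ∂(gaussianMeasure n) +
      ∫ x, g (u x) * gdiv n ψ x ∂(gaussianMeasure n) ≤ V := by
  have hul := locallyIntegrable_of_gaussianMeasure hu
  obtain ⟨R, hR⟩ := (hφc.isCompact.union hψc.isCompact).isBounded.subset_closedBall (0 : 𝔼)
  obtain ⟨η, hη_in, hη_out⟩ : ∃ η : ℕ → ContDiffBump (0 : 𝔼),
      (∀ k, (η k).rIn = 1 / ((k : ℝ) + 1) / 2) ∧ ∀ k, (η k).rOut = 1 / ((k : ℝ) + 1) :=
    ⟨fun k => ⟨1 / ((k : ℝ) + 1) / 2, 1 / ((k : ℝ) + 1), by positivity,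
      half_lt_self (by positivity)⟩, fun _ => rfl, fun _ => rfl⟩
  have hlim : Tendsto (fun k => (η k).rOut) atTop (𝓝 0) := by
    simp only [hη_out]
    exact tendsto_one_div_add_atTop_nhds_zero_nat
  have hae : ∀ᵐ x, Tendsto (fun k => mollify (η k) u x) atTop (𝓝 (u x)) :=
    ContDiffBump.ae_convolution_tendsto_right_of_locallyIntegrable hlim (K := 2)
      (Eventually.of_forall fun k => by rw [hη_in, hη_out]; linarith) hul
  have hv : ∀ k, ContDiff ℝ 1 (mollify (η k) u) := fun k =>
    (contDiff_mollify (η k) hul).of_le (by simp)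
  have hle : ∀ k, ∫ x, f (mollify (η k) u x) * gdiv n φ x ∂(gaussianMeasure n) +
      ∫ x, g (mollify (η k) u x) * gdiv n ψ x ∂(gaussianMeasure n) ≤
        Real.exp ((η k).rOut * (2 * R + 1) / 2) * V := by
    intro k
    have hvk := hv k
    generalize hvdef : mollify (η k) u = v at hvk ⊢
    have h1 : ContDiff ℝ 1 fun x => deriv f (v x) • φ x :=
      ((hf.deriv' (n := 1)).comp hvk).smul hφ
    have h2 : ContDiff ℝ 1 fun x => deriv g (v x) • ψ x :=
      ((hg.deriv' (n := 1)).comp hvk).smul hψ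
    have h1c : HasCompactSupport fun x => deriv f (v x) • φ x :=
      hφc.smul_left (f := fun x => deriv f (v x))
    have h2c : HasCompactSupport fun x => deriv g (v x) • ψ x :=
      hψc.smul_left (f := fun x => deriv g (v x))
    have hi {χ : 𝔼 → 𝔼} (h : ContDiff ℝ 1 χ) (hc : HasCompactSupport χ) :
        Integrable (fun x => v x * gdiv n χ x) (gaussianMeasure n) :=
      (hvk.continuous.mul (continuous_gdiv h)).integrable_gaussianMeasure
        ((hasCompactSupport_gdiv hc).mul_left (f := v))
    have := integral_mollify_mul_gdiv_le hu hV (ψ := fun x => deriv f (v x) • φ x +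
      deriv g (v x) • ψ x) (h1.add h2) (h1c.add h2c) (fun x => ?_) (R := R) (fun x hx => ?_) (η k)
      (by rw [hη_out, div_le_one (by positivity)]; linarith [k.cast_nonneg (α := ℝ)])
    · rw [hvdef] at this
      simp only [gdiv_add (h1.differentiable one_ne_zero _) (h2.differentiable one_ne_zero _),
        mul_add (v _)] at this
      rwa [integral_add (hi h1 h1c) (hi h2 h2c), integral_mul_gdiv_deriv_smul hf hvk hφ hφc,
        integral_mul_gdiv_deriv_smul hg hvk hψ hψc] at this
    · calc ‖deriv f (v x) • φ x + deriv g (v x) • ψ x‖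
          ≤ deriv f (v x) * ‖φ x‖ + deriv g (v x) * ‖ψ x‖ := by
            refine (norm_add_le _ _).trans_eq ?_
            rw [norm_smul, norm_smul, Real.norm_of_nonneg (hf0 _), Real.norm_of_nonneg (hg0 _)]
        _ ≤ deriv f (v x) * 1 + deriv g (v x) * 1 := by
            gcongr
            · exact hf0 _
            · exact hφ1 x
            · exact hg0 _
            · exact hψ1 x
        _ ≤ 1 := by simpa using hfg (v x)
    · have : x ∈ tsupport φ ∪ tsupport ψ := by
        by_contra hcon
        rw [Set.mem_union, not_or] at hcon
        refine hx ?_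
        simp only [image_eq_zero_of_notMem_tsupport hcon.1,
          image_eq_zero_of_notMem_tsupport hcon.2, smul_zero, add_zero]
      simpa using hR this
  have l1 := tendsto_integral_comp_mul hf.continuous hfM (fun k => (hv k).continuous) hae
    ((continuous_gdiv hφ).integrable_gaussianMeasure (hasCompactSupport_gdiv hφc))
  have l2 := tendsto_integral_comp_mul hg.continuous hgM (fun k => (hv k).continuous) hae
    ((continuous_gdiv hψ).integrable_gaussianMeasure (hasCompactSupport_gdiv hψc))
  have l3 : Tendsto (fun k => Real.exp ((η k).rOut * (2 * R + 1) / 2) * V) atTop (𝓝 V) := by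
    have := (((hlim.mul_const (2 * R + 1)).div_const 2).rexp).mul_const V
    simpa using this
  exact le_of_tendsto_of_tendsto' (l1.add l2) l3 hle

theorem integrable_exp_neg_norm_sq_div_four :
    Integrable fun x : 𝔼 => Real.exp (-‖x‖ ^ 2 / 4) := by
  have := (GaussianFourier.integrable_cexp_neg_mul_sq_norm_add (V := 𝔼) (b := 1 / 4)
    (by norm_num) 0 0).norm
  refine this.congr (Eventually.of_forall fun x => ?_)
  simp only [Complex.norm_exp]
  congr 1
  have : (-(1 / 4 : ℂ) * (‖x‖ : ℂ) ^ 2 + 0 * ((inner ℝ (0 : 𝔼) x : ℝ) : ℂ)) =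
      ((-‖x‖ ^ 2 / 4 : ℝ) : ℂ) := by
    push_cast
    ring
  rw [this, Complex.ofReal_re]

theorem integrable_one_add_norm_gaussianMeasure :
    Integrable (fun x : 𝔼 => 1 + ‖x‖) (gaussianMeasure n) := by
  rw [integrable_gaussianMeasure_iff]
  have hc := continuous_gaussianWeight (n := n)
  refine (integrable_exp_neg_norm_sq_div_four.const_mul ((2 * π) ^ (-(n : ℝ) / 2) * 3)).mono'
    (by fun_prop) (Eventually.of_forall fun x => ?_)
  have hw := gaussianWeight_pos x
  rw [Real.norm_of_nonneg (by positivity)]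
  have h1 : 1 + ‖x‖ ≤ 3 * Real.exp (‖x‖ ^ 2 / 4) := by
    nlinarith [Real.add_one_le_exp (‖x‖ ^ 2 / 4), sq_nonneg (‖x‖ - 2), sq_nonneg ‖x‖]
  have h2 : Real.exp (-‖x‖ ^ 2 / 4) =
      Real.exp (-‖x‖ ^ 2 / 2) * Real.exp (‖x‖ ^ 2 / 4) := by
    rw [← Real.exp_add]
    ring_nf
  rw [h2]
  calc gaussianWeight n x * (1 + ‖x‖) ≤ gaussianWeight n x * (3 * Real.exp (‖x‖ ^ 2 / 4)) := by
        gcongr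
    _ = _ := by
        rw [gaussianWeight]
        ring

theorem integrable_const_gaussianMeasure (c : ℝ) :
    Integrable (fun _ : 𝔼 => c) (gaussianMeasure n) := by
  refine (integrable_one_add_norm_gaussianMeasure.const_mul |c|).mono' (by fun_prop)
    (Eventually.of_forall fun x => ?_)
  rw [Real.norm_eq_abs]
  exact le_mul_of_one_le_right (abs_nonneg c) (by linarith [norm_nonneg x])

theorem Admissible.integrable_gdiv {φ : 𝔼 → 𝔼} (hφ : Admissible n φ) :
    Integrable (gdiv n φ) (gaussianMeasure n) := by
  obtain ⟨hd, ⟨M, hM⟩, h1⟩ := hφ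
  have hM0 : 0 ≤ M := (norm_nonneg _).trans (hM 0)
  refine (integrable_one_add_norm_gaussianMeasure.const_mul (‖traceFunctional n‖ * M + 1)).mono'
    (continuous_gdiv hd).aestronglyMeasurable (Eventually.of_forall fun x => ?_)
  have e1 : ‖divergence n φ x‖ ≤ ‖traceFunctional n‖ * M :=
    ((traceFunctional n).le_opNorm _).trans (by gcongr; exact hM x)
  have e2 : ‖⟪x, φ x⟫‖ ≤ ‖x‖ :=
    (norm_inner_le_norm _ _).trans (mul_le_of_le_one_right (norm_nonneg x) (h1 x))
  rw [gdiv_eq]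
  have := norm_sub_le (divergence n φ x) ⟪x, φ x⟫
  have : 0 ≤ ‖traceFunctional n‖ * M * ‖x‖ := by positivity
  linarith

theorem Admissible.neg {φ : 𝔼 → 𝔼} (hφ : Admissible n φ) : Admissible n fun x => -φ x := by
  obtain ⟨hd, ⟨M, hM⟩, h1⟩ := hφ
  refine ⟨hd.neg, ⟨M, fun x => ?_⟩, fun x => ?_⟩
  · rw [fderiv_fun_neg, norm_neg]
    exact hM x
  · rw [norm_neg]
    exact h1 x

theorem gdiv_neg (φ : 𝔼 → 𝔼) (x : 𝔼) : gdiv n (fun y => -φ y) x = -gdiv n φ x := by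
  rw [gdiv_eq, gdiv_eq, divergence, divergence, fderiv_fun_neg, map_neg, inner_neg_right]
  ring

theorem admissible_of_hasCompactSupport {φ : 𝔼 → 𝔼} (hφ : ContDiff ℝ 1 φ)
    (hc : HasCompactSupport φ) (h1 : ∀ x, ‖φ x‖ ≤ 1) : Admissible n φ :=
  ⟨hφ, (hc.fderiv ℝ).exists_bound_of_continuous (hφ.continuous_fderiv one_ne_zero), h1⟩

/-- Smooth cutoff functions exhausting the space, with gradients bounded by a common constant. -/
theorem exists_cutoff : ∃ a : ℕ → 𝔼 → ℝ, ∃ C : ℝ, (∀ k, ContDiff ℝ 1 (a k)) ∧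
    (∀ k, HasCompactSupport (a k)) ∧ (∀ k x, 0 ≤ a k x) ∧ (∀ k x, a k x ≤ 1) ∧
    (∀ x, ∀ᶠ k in atTop, a k =ᶠ[𝓝 x] fun _ => 1) ∧ ∀ k x, ‖fderiv ℝ (a k) x‖ ≤ C := by
  obtain ⟨b, hb⟩ : ∃ b : ContDiffBump (0 : 𝔼), b.rIn = 1 :=
    ⟨⟨1, 2, one_pos, one_lt_two⟩, rfl⟩
  have hbd : ContDiff ℝ 1 b := b.contDiff
  obtain ⟨C, hC⟩ := (b.hasCompactSupport.fderiv ℝ).exists_bound_of_continuous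
    (hbd.continuous_fderiv one_ne_zero)
  have hpos : ∀ k : ℕ, (0 : ℝ) < ((k : ℝ) + 1)⁻¹ := fun k => by positivity
  have hlin : ∀ c : ℝ, ContDiff ℝ 1 fun x : 𝔼 => c • x := fun c => contDiff_id.const_smul c
  refine ⟨fun k x => b (((k : ℝ) + 1)⁻¹ • x), C, fun k => hbd.comp (hlin _), fun k => ?_,
    fun _ _ => b.nonneg, fun _ _ => b.le_one, fun x => ?_, fun k x => ?_⟩
  · exact b.hasCompactSupport.comp_homeomorph (Homeomorph.smulOfNeZero _ (hpos k).ne')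
  · filter_upwards [eventually_gt_atTop ⌈‖x‖⌉₊] with k hk
    have hxk : ‖x‖ < (k : ℝ) + 1 := by
      have := (Nat.le_ceil ‖x‖).trans_lt (Nat.cast_lt.2 hk)
      linarith
    have : ∀ᶠ y in 𝓝 x, ‖y‖ < (k : ℝ) + 1 := continuous_norm.continuousAt.eventually_lt_const hxk
    filter_upwards [this] with y hy
    refine b.one_of_mem_closedBall ?_
    rw [mem_closedBall_zero_iff, norm_smul, Real.norm_of_nonneg (hpos k).le, hb,
      inv_mul_le_iff₀ (by positivity)]
    linarith
  · rw [fderiv_comp_smul, norm_smul, Real.norm_of_nonneg (hpos k).le]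
    refine (mul_le_of_le_one_left (norm_nonneg _) ?_).trans (hC _)
    exact inv_le_one_of_one_le₀ (by linarith [k.cast_nonneg (α := ℝ)])

theorem Admissible.exists_tendsto_gdiv {φ : 𝔼 → 𝔼} (hφ : Admissible n φ) :
    ∃ Φ : ℕ → 𝔼 → 𝔼, (∀ k, ContDiff ℝ 1 (Φ k)) ∧ (∀ k, HasCompactSupport (Φ k)) ∧
      (∀ k x, ‖Φ k x‖ ≤ 1) ∧ ∀ (h : 𝔼 → ℝ) (M : ℝ), AEStronglyMeasurable h (gaussianMeasure n) →
        (∀ x, |h x| ≤ M) → Tendsto (fun k => ∫ x, h x * gdiv n (Φ k) x ∂(gaussianMeasure n)) atTop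
          (𝓝 (∫ x, h x * gdiv n φ x ∂(gaussianMeasure n))) := by
  obtain ⟨a, C, had, hac, ha0, ha1, halim, hC⟩ := exists_cutoff (n := n)
  have hΦ : ∀ k, ContDiff ℝ 1 fun x => a k x • φ x := fun k => (had k).smul hφ.1
  refine ⟨fun k x => a k x • φ x, hΦ, fun k => (hac k).smul_right, fun k x => ?_,
    fun h M hh hM => ?_⟩
  · rw [norm_smul, Real.norm_of_nonneg (ha0 k x)]
    exact mul_le_one₀ (ha1 k x) (norm_nonneg _) (hφ.2.2 x)
  have hgd : ∀ k x, gdiv n (fun y => a k y • φ y) x =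
      a k x * gdiv n φ x + fderiv ℝ (a k) x (φ x) := by
    intro k x
    rw [gdiv_eq, gdiv_eq, divergence_smul ((had k).differentiable one_ne_zero x)
      (hφ.1.differentiable one_ne_zero x), real_inner_smul_right]
    ring
  refine tendsto_integral_of_dominated_convergence (fun x => M * (|gdiv n φ x| + C))
    (fun k => hh.mul (continuous_gdiv (hΦ k)).aestronglyMeasurable)
    ((hφ.integrable_gdiv.abs.add (integrable_const_gaussianMeasure C)).const_mul M)
    (fun k => Eventually.of_forall fun x => ?_) (Eventually.of_forall fun x => ?_)
  · rw [Real.norm_eq_abs, abs_mul, hgd]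
    have e1 : |a k x * gdiv n φ x| ≤ |gdiv n φ x| := by
      rw [abs_mul, abs_of_nonneg (ha0 k x)]
      exact mul_le_of_le_one_left (abs_nonneg _) (ha1 k x)
    have e2 : |fderiv ℝ (a k) x (φ x)| ≤ C :=
      ((fderiv ℝ (a k) x).le_opNorm _).trans
        ((mul_le_of_le_one_right (norm_nonneg _) (hφ.2.2 x)).trans (hC k x))
    exact mul_le_mul (hM x) ((abs_add_le _ _).trans (add_le_add e1 e2)) (abs_nonneg _)
      ((abs_nonneg _).trans (hM x))
  · refine tendsto_const_nhds.congr' ?_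
    filter_upwards [halim x] with k hk
    rw [hgd, hk.fderiv_eq, hk.eq_of_nhds, fderiv_fun_const]
    simp

theorem Admissible.integral_gdiv {φ : 𝔼 → 𝔼} (hφ : Admissible n φ) :
    ∫ x, gdiv n φ x ∂(gaussianMeasure n) = 0 := by
  obtain ⟨Φ, hd, hc, -, hlim⟩ := hφ.exists_tendsto_gdiv
  have h0 : ∀ k, ∫ x, gdiv n (Φ k) x ∂(gaussianMeasure n) = 0 := by
    intro k
    rw [integral_gaussianMeasure]
    simp only [gaussianWeight_mul_gdiv ((hd k).differentiable one_ne_zero _)]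
    exact integral_divergence_eq_zero ((contDiff_gaussianWeight.of_le (by simp)).smul (hd k))
      ((hc k).smul_left (f := gaussianWeight n))
  have := hlim (fun _ => 1) 1 aestronglyMeasurable_const (by simp)
  simp only [one_mul, h0] at this
  exact tendsto_nhds_unique this tendsto_const_nhds

theorem integral_mul_gdiv_le_totVar {u : 𝔼 → ℝ} (hfin : totVar n u ≠ ⊤) {φ : 𝔼 → 𝔼}
    (hφ : Admissible n φ) :
    ∫ x, u x * gdiv n φ x ∂(gaussianMeasure n) ≤ (totVar n u).toReal := by
  rw [← ENNReal.ofReal_le_iff_le_toReal hfin]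
  exact le_iSup₂ (f := fun (φ : 𝔼 → 𝔼) (_ : Admissible n φ) =>
    ENNReal.ofReal (∫ x, u x * gdiv n φ x ∂(gaussianMeasure n))) φ hφ

theorem integral_comp_mul_gdiv_add_le {u : 𝔼 → ℝ} (hu : Integrable u (gaussianMeasure n))
    (hfin : totVar n u ≠ ⊤) {f g : ℝ → ℝ} (hf : ContDiff ℝ 2 f) (hg : ContDiff ℝ 2 g)
    (hf0 : ∀ t, 0 ≤ deriv f t) (hg0 : ∀ t, 0 ≤ deriv g t)
    (hfg : ∀ t, deriv f t + deriv g t ≤ 1) {M : ℝ} (hfM : ∀ t, |f t| ≤ M) (hgM : ∀ t, |g t| ≤ M)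
    {φ ψ : 𝔼 → 𝔼} (hφ : Admissible n φ) (hψ : Admissible n ψ) :
    ∫ x, f (u x) * gdiv n φ x ∂(gaussianMeasure n) +
      ∫ x, g (u x) * gdiv n ψ x ∂(gaussianMeasure n) ≤ (totVar n u).toReal := by
  obtain ⟨Φ, hΦ, hΦc, hΦ1, hΦlim⟩ := hφ.exists_tendsto_gdiv
  obtain ⟨Ψ, hΨ, hΨc, hΨ1, hΨlim⟩ := hψ.exists_tendsto_gdiv
  refine le_of_tendsto' ((hΦlim (fun x => f (u x)) M
    (hf.continuous.comp_aestronglyMeasurable hu.aestronglyMeasurable) fun x => hfM _).add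
    (hΨlim (fun x => g (u x)) M
      (hg.continuous.comp_aestronglyMeasurable hu.aestronglyMeasurable) fun x => hgM _)) fun k => ?_
  exact integral_comp_mul_gdiv_add_le_of_hasCompactSupport hu
    (fun χ h hc h1 => integral_mul_gdiv_le_totVar hfin (admissible_of_hasCompactSupport h hc h1))
    hf hg hf0 hg0 hfg hfM hgM (hΦ k) (hΨ k) (hΦc k) (hΨc k) (hΦ1 k) (hΨ1 k)

theorem hasDerivAt_mul_arctan_div {c : ℝ} (hc : 0 < c) (t : ℝ) :
    HasDerivAt (fun s => c * arctan (s / c)) (1 / (1 + (t / c) ^ 2)) t := by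
  have h := (((hasDerivAt_id' t).div_const c).arctan).const_mul c
  rwa [mul_one_div, mul_div_cancel₀ _ hc.ne'] at h

theorem abs_mul_arctan_div_le {c : ℝ} (hc : 0 < c) (t : ℝ) : |c * arctan (t / c)| ≤ |t| := by
  have hn : ∀ s : ℝ, ‖deriv (fun s => c * arctan (s / c)) s‖ ≤ 1 := fun s => by
    rw [(hasDerivAt_mul_arctan_div hc s).deriv, Real.norm_of_nonneg (by positivity)]
    exact div_le_one_of_le₀ (by nlinarith [sq_nonneg (s / c)]) (by positivity)
  simpa using convex_univ.norm_image_sub_le_of_norm_deriv_le (𝕜 := ℝ) (x := 0) (y := t)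
    (fun s _ => (hasDerivAt_mul_arctan_div hc s).differentiableAt) (fun s _ => hn s)
    (Set.mem_univ _) (Set.mem_univ _)

theorem tendsto_mul_arctan_div (t : ℝ) :
    Tendsto (fun k : ℕ => ((k : ℝ) + 1) * arctan (t / ((k : ℝ) + 1))) atTop (𝓝 t) := by
  have h := (hasDerivAt_arctan 0).tendsto_slope_zero
  rcases eq_or_ne t 0 with rfl | ht
  · simp
  have h1 : Tendsto (fun k : ℕ => t / ((k : ℝ) + 1)) atTop (𝓝[≠] 0) := by
    refine tendsto_nhdsWithin_iff.2 ⟨?_, Eventually.of_forall fun k => ?_⟩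
    · exact tendsto_const_nhds.div_atTop (tendsto_atTop_add_const_right _ _
        tendsto_natCast_atTop_atTop)
    · exact div_ne_zero ht (by positivity)
  have h2 := (h.comp h1).const_mul t
  simp only [zero_add, arctan_zero, sub_zero, smul_eq_mul, Function.comp_def] at h2
  refine Tendsto.congr (fun k => ?_) (h2.trans (by simp))
  field_simp

/-- A calibrating field for `u` also calibrates `S ∘ u` for every smooth bounded nondecreasing
`1`-Lipschitz function `S`. -/
theorem integral_comp_mul_gdiv_le {u : 𝔼 → ℝ} (hu : Integrable u (gaussianMeasure n))
    (hfin : totVar n u ≠ ⊤) {z : 𝔼 → 𝔼} (hz : Admissible n z)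
    (heq : (totVar n u).toReal = ∫ x, u x * gdiv n z x ∂(gaussianMeasure n))
    {S : ℝ → ℝ} (hS : ContDiff ℝ 2 S) (hS0 : ∀ t, 0 ≤ deriv S t) (hS1 : ∀ t, deriv S t ≤ 1)
    {M : ℝ} (hSM : ∀ t, |S t| ≤ M) {φ : 𝔼 → 𝔼} (hφ : Admissible n φ) :
    ∫ x, S (u x) * gdiv n φ x ∂(gaussianMeasure n) ≤
      ∫ x, S (u x) * gdiv n z x ∂(gaussianMeasure n) := by
  by_cases hi : Integrable (fun x => u x * gdiv n z x) (gaussianMeasure n)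
  · have hT : ∀ k : ℕ, ∃ T : ℝ → ℝ, T = fun s => ((k : ℝ) + 1) * arctan (s / ((k : ℝ) + 1)) :=
      fun _ => ⟨_, rfl⟩
    choose T hT using hT
    have hk : ∀ k : ℕ, (0 : ℝ) < (k : ℝ) + 1 := fun k => by positivity
    have hTd : ∀ k, ContDiff ℝ 2 (T k) := fun k => by
      rw [hT]
      exact contDiff_const.mul (contDiff_arctan.comp (contDiff_id.div_const _))
    have hT' : ∀ k t, HasDerivAt (T k) (1 / (1 + (t / ((k : ℝ) + 1)) ^ 2)) t := fun k t => by
      rw [hT]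
      exact hasDerivAt_mul_arctan_div (hk k) t
    have hT0 : ∀ k t, 0 ≤ deriv (T k) t := fun k t => by
      rw [(hT' k t).deriv]
      positivity
    have hT1 : ∀ k t, deriv (T k) t ≤ 1 := fun k t => by
      rw [(hT' k t).deriv]
      exact div_le_one_of_le₀ (by nlinarith [sq_nonneg (t / ((k : ℝ) + 1))]) (by positivity)
    have hTle : ∀ k t, |T k t| ≤ |t| := fun k t => by
      rw [hT]
      exact abs_mul_arctan_div_le (hk k) t
    have hTM : ∀ k t, |T k t| ≤ ((k : ℝ) + 1) * (π / 2) := fun k t => by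
      rw [hT, abs_mul, abs_of_pos (hk k)]
      gcongr
      exact abs_le.2 ⟨(neg_pi_div_two_lt_arctan _).le, (arctan_lt_pi_div_two _).le⟩
    have hTlim : ∀ t, Tendsto (fun k => T k t) atTop (𝓝 t) := fun t => by
      simp only [hT]
      exact tendsto_mul_arctan_div t
    have hfd : ∀ k, ContDiff ℝ 2 fun t => S (T k t) := fun k => hS.comp (hTd k)
    have hgd : ∀ k, ContDiff ℝ 2 fun t => T k t - S (T k t) := fun k => (hTd k).sub (hfd k)
    have hf' : ∀ k t, deriv (fun t => S (T k t)) t = deriv S (T k t) * deriv (T k) t := fun k t =>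
      ((hS.differentiable two_ne_zero (T k t)).hasDerivAt.comp t
        ((hTd k).differentiable two_ne_zero t).hasDerivAt).deriv
    have hg' : ∀ k t, deriv (fun t => T k t - S (T k t)) t =
        deriv (T k) t - deriv S (T k t) * deriv (T k) t := fun k t => by
      rw [deriv_fun_sub ((hTd k).differentiable two_ne_zero t)
        ((hfd k).differentiable two_ne_zero t), hf']
    have hM0 : 0 ≤ M := (abs_nonneg _).trans (hSM 0)
    have hle : ∀ k, ∫ x, S (T k (u x)) * gdiv n φ x ∂(gaussianMeasure n) +
        ∫ x, (T k (u x) - S (T k (u x))) * gdiv n z x ∂(gaussianMeasure n) ≤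
          (totVar n u).toReal := fun k => by
      refine integral_comp_mul_gdiv_add_le hu hfin (hfd k) (hgd k) (fun t => ?_) (fun t => ?_)
        (fun t => ?_) (M := ((k : ℝ) + 1) * (π / 2) + M) (fun t => ?_) (fun t => ?_) hφ hz
      · rw [hf']
        exact mul_nonneg (hS0 _) (hT0 k t)
      · rw [hg', sub_nonneg]
        exact mul_le_of_le_one_left (hT0 k t) (hS1 _)
      · rw [hf', hg']
        linarith [hT1 k t]
      · have : 0 ≤ ((k : ℝ) + 1) * (π / 2) := by positivity
        linarith [hSM (T k t)]
      · exact (abs_sub _ _).trans (add_le_add (hTM k t) (hSM _))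
    have haesm {h : ℝ → ℝ} (hh : ContDiff ℝ 2 h) :
        AEStronglyMeasurable (fun x => h (u x)) (gaussianMeasure n) :=
      hh.continuous.comp_aestronglyMeasurable hu.aestronglyMeasurable
    have hInt {χ : 𝔼 → 𝔼} (hχ : Admissible n χ) :
        Integrable (fun x => S (u x) * gdiv n χ x) (gaussianMeasure n) :=
      hχ.integrable_gdiv.bdd_mul (haesm hS) (Eventually.of_forall fun x => hSM _)
    have l1 : Tendsto (fun k => ∫ x, S (T k (u x)) * gdiv n φ x ∂(gaussianMeasure n)) atTop
        (𝓝 (∫ x, S (u x) * gdiv n φ x ∂(gaussianMeasure n))) := by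
      refine tendsto_integral_of_dominated_convergence (fun x => M * |gdiv n φ x|)
        (fun k => (haesm (hfd k)).mul hφ.integrable_gdiv.aestronglyMeasurable)
        (hφ.integrable_gdiv.abs.const_mul M)
        (fun k => Eventually.of_forall fun x => ?_) (Eventually.of_forall fun x => ?_)
      · rw [Real.norm_eq_abs, abs_mul]
        exact mul_le_mul_of_nonneg_right (hSM _) (abs_nonneg _)
      · exact ((hS.continuous.tendsto _).comp (hTlim (u x))).mul_const _
    have l2 : Tendsto (fun k => ∫ x, (T k (u x) - S (T k (u x))) * gdiv n z x ∂(gaussianMeasure n))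
        atTop (𝓝 (∫ x, (u x - S (u x)) * gdiv n z x ∂(gaussianMeasure n))) := by
      refine tendsto_integral_of_dominated_convergence
        (fun x => |u x * gdiv n z x| + M * |gdiv n z x|)
        (fun k => (haesm (hgd k)).mul hz.integrable_gdiv.aestronglyMeasurable)
        (hi.abs.add (hz.integrable_gdiv.abs.const_mul M))
        (fun k => Eventually.of_forall fun x => ?_) (Eventually.of_forall fun x => ?_)
      · rw [Real.norm_eq_abs, abs_mul, abs_mul, ← add_mul]
        exact mul_le_mul_of_nonneg_right ((abs_sub _ _).trans (add_le_add (hTle k _) (hSM _)))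
          (abs_nonneg _)
      · exact ((hTlim (u x)).sub ((hS.continuous.tendsto _).comp (hTlim (u x)))).mul_const _
    have := le_of_tendsto' (l1.add l2) hle
    simp only [sub_mul] at this
    rw [integral_sub hi (hInt hz), heq] at this
    linarith
  · have h0 : (totVar n u).toReal = 0 := heq.trans (integral_undef hi)
    have key : ∀ {χ : 𝔼 → 𝔼}, Admissible n χ →
        ∫ x, S (u x) * gdiv n χ x ∂(gaussianMeasure n) ≤ 0 := fun {χ} hχ => by
      have := integral_comp_mul_gdiv_add_le hu hfin hS (contDiff_const (c := (0 : ℝ))) hS0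
        (by simp) (by simpa using hS1) hSM (by simpa using (abs_nonneg _).trans (hSM 0)) hχ hχ
      simpa [h0] using this
    have hneg := key hz.neg
    simp only [gdiv_neg, mul_neg, integral_neg] at hneg
    linarith [key hφ]

theorem tendsto_one_sub_sigmoid (t : ℝ) :
    Tendsto (fun k : ℕ => 1 - sigmoid (((k : ℝ) + 1) ^ 2 * t + ((k : ℝ) + 1))) atTop
      (𝓝 ({s : ℝ | s < 0}.indicator (fun _ => 1) t)) := by
  have hk : Tendsto (fun k : ℕ => (k : ℝ) + 1) atTop atTop :=
    tendsto_atTop_add_const_right _ _ tendsto_natCast_atTop_atTop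
  rcases lt_or_ge t 0 with ht | ht
  · rw [Set.indicator_of_mem (by exact ht)]
    have h1 : Tendsto (fun k : ℕ => ((k : ℝ) + 1) * (((k : ℝ) + 1) * t + 1)) atTop atBot :=
      hk.atTop_mul_atBot₀ (tendsto_atBot_add_const_right _ _ (hk.atTop_mul_const_of_neg ht))
    have h2 := (Real.tendsto_sigmoid_atBot.comp h1).const_sub 1
    rw [sub_zero] at h2
    refine h2.congr fun k => ?_
    simp only [Function.comp_apply]
    ring_nf
  · rw [Set.indicator_of_notMem (by simpa using ht)]
    have h1 : Tendsto (fun k : ℕ => ((k : ℝ) + 1) ^ 2 * t + ((k : ℝ) + 1)) atTop atTop :=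
      tendsto_atTop_mono (fun k => le_add_of_nonneg_left (by positivity)) hk
    have h2 := (Real.tendsto_sigmoid_atTop.comp h1).const_sub 1
    rwa [sub_self] at h2

theorem setIntegral_gdiv_le {u : 𝔼 → ℝ} (hu : Integrable u (gaussianMeasure n))
    (hfin : totVar n u ≠ ⊤) {z : 𝔼 → 𝔼} (hz : Admissible n z)
    (heq : (totVar n u).toReal = ∫ x, u x * gdiv n z x ∂(gaussianMeasure n)) (r : ℝ)
    {φ : 𝔼 → 𝔼} (hφ : Admissible n φ) :
    ∫ x, {x | u x < r}.indicator (fun _ => 1) x * gdiv n z x ∂(gaussianMeasure n) ≤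
      ∫ x, {x | u x < r}.indicator (fun _ => 1) x * gdiv n φ x ∂(gaussianMeasure n) := by
  obtain ⟨h, hh⟩ : ∃ h : ℕ → ℝ → ℝ,
      h = fun (k : ℕ) t => sigmoid (((k : ℝ) + 1) ^ 2 * (t - r) + ((k : ℝ) + 1)) := ⟨_, rfl⟩
  have hd : ∀ k, ContDiff ℝ 2 (h k) := fun k => by
    rw [hh]
    exact (contDiff_sigmoid.of_le le_top).comp
      ((contDiff_const.mul (contDiff_id.sub contDiff_const)).add contDiff_const)
  have hderiv : ∀ k t, ∃ s, deriv (h k) t = s * (1 - s) * ((k : ℝ) + 1) ^ 2 ∧ 0 ≤ s ∧ s ≤ 1 :=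
    fun k t => by
      refine ⟨_, ?_, sigmoid_nonneg (((k : ℝ) + 1) ^ 2 * (t - r) + ((k : ℝ) + 1)), sigmoid_le_one _⟩
      have := (hasDerivAt_sigmoid (((k : ℝ) + 1) ^ 2 * (t - r) + ((k : ℝ) + 1))).comp t
        ((((hasDerivAt_id' t).sub_const r).const_mul (((k : ℝ) + 1) ^ 2)).add_const ((k : ℝ) + 1))
      rw [hh]
      simpa only [mul_one, Function.comp_def] using this.deriv
  have hm : ∀ k, AEStronglyMeasurable (fun x => h k (u x)) (gaussianMeasure n) := fun k =>
    (hd k).continuous.comp_aestronglyMeasurable hu.aestronglyMeasurable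
  have hb0 : ∀ k t, 0 ≤ h k t := fun k t => by
    rw [hh]
    exact sigmoid_nonneg _
  have hb1 : ∀ k t, h k t ≤ 1 := fun k t => by
    rw [hh]
    exact sigmoid_le_one _
  have hle : ∀ k, ∫ x, (1 - h k (u x)) * gdiv n z x ∂(gaussianMeasure n) ≤
      ∫ x, (1 - h k (u x)) * gdiv n φ x ∂(gaussianMeasure n) := by
    intro k
    have hk : (0 : ℝ) < ((k : ℝ) + 1) ^ 2 := by positivity
    have hsd : ∀ t, deriv (fun t => h k t / ((k : ℝ) + 1) ^ 2) t =
        deriv (h k) t / ((k : ℝ) + 1) ^ 2 := fun t => deriv_div_const _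
    have := integral_comp_mul_gdiv_le hu hfin hz heq (S := fun t => h k t / ((k : ℝ) + 1) ^ 2)
      ((hd k).div_const _) (fun t => ?_) (fun t => ?_) (M := 1 / ((k : ℝ) + 1) ^ 2) (fun t => ?_) hφ
    · simp only [div_mul_eq_mul_div, integral_div] at this
      have hInt {χ : 𝔼 → 𝔼} (hχ : Admissible n χ) :
          ∫ x, (1 - h k (u x)) * gdiv n χ x ∂(gaussianMeasure n) =
            -∫ x, h k (u x) * gdiv n χ x ∂(gaussianMeasure n) := by
        simp only [sub_mul, one_mul]
        rw [integral_sub hχ.integrable_gdiv, hχ.integral_gdiv, zero_sub]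
        refine hχ.integrable_gdiv.bdd_mul (c := 1) (hm k) (Eventually.of_forall fun x => ?_)
        rw [Real.norm_of_nonneg (hb0 k _)]
        exact hb1 k _
      rw [hInt hz, hInt hφ]
      exact neg_le_neg ((div_le_div_iff_of_pos_right hk).1 this)
    · obtain ⟨s, hs, hs0, hs1⟩ := hderiv k t
      rw [hsd, hs, mul_div_cancel_right₀ _ hk.ne']
      exact mul_nonneg hs0 (sub_nonneg.2 hs1)
    · obtain ⟨s, hs, hs0, hs1⟩ := hderiv k t
      rw [hsd, hs, mul_div_cancel_right₀ _ hk.ne']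
      nlinarith
    · rw [abs_div, abs_of_nonneg (hb0 k t), abs_of_pos hk]
      exact div_le_div_of_nonneg_right (hb1 k t) hk.le
  have hlim {χ : 𝔼 → 𝔼} (hχ : Admissible n χ) :
      Tendsto (fun k => ∫ x, (1 - h k (u x)) * gdiv n χ x ∂(gaussianMeasure n)) atTop
        (𝓝 (∫ x, {x | u x < r}.indicator (fun _ => 1) x * gdiv n χ x ∂(gaussianMeasure n))) := by
    refine tendsto_integral_of_dominated_convergence (fun x => |gdiv n χ x|)
      (fun k => (aestronglyMeasurable_const.sub (hm k)).mul
        hχ.integrable_gdiv.aestronglyMeasurable) hχ.integrable_gdiv.abs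
      (fun k => Eventually.of_forall fun x => ?_) (Eventually.of_forall fun x => ?_)
    · rw [Real.norm_eq_abs, abs_mul, abs_of_nonneg (sub_nonneg.2 (hb1 k _))]
      exact mul_le_of_le_one_left (abs_nonneg _) (by linarith [hb0 k (u x)])
    · have := (tendsto_one_sub_sigmoid (u x - r)).mul_const (gdiv n χ x)
      simp only [hh]
      simpa [Set.indicator_apply, sub_neg] using this
  exact le_of_tendsto_of_tendsto' (hlim hz) (hlim hφ) hle

end GaussianVariation

/-- If `u ∈ L¹(γ_n)` has finite Gaussian total variation and `z` is an
admissible vector field attaining the supremum, i.e. `V_γ(u) = ∫ u · div_γ z dγ_n`, then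
for every `r ∈ ℝ` the sublevel set `{u < r}` satisfies
`P_γ({u < r}) = −∫_{u<r} div_γ z dγ_n ≤ ∫ |div_γ z| dγ_n`. -/
theorem perimeter_of_sublevel_sets
    (n : ℕ) (u : EuclideanSpace ℝ (Fin n) → ℝ)
    (hu : Integrable u (gaussianMeasure n)) (hfin : totVar n u ≠ ⊤)
    (z : EuclideanSpace ℝ (Fin n) → EuclideanSpace ℝ (Fin n)) (hz : Admissible n z)
    (heq : (totVar n u).toReal = ∫ x, u x * gdiv n z x ∂(gaussianMeasure n)) :
    ∀ r : ℝ,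
      gPerimeter n {x | u x < r} =
        ENNReal.ofReal (-∫ x in {x | u x < r}, gdiv n z x ∂(gaussianMeasure n)) ∧
      gPerimeter n {x | u x < r} ≤
        ENNReal.ofReal (∫ x, |gdiv n z x| ∂(gaussianMeasure n)) := by
  intro r
  have hA : NullMeasurableSet {x | u x < r} (gaussianMeasure n) :=
    nullMeasurableSet_lt hu.aestronglyMeasurable.aemeasurable aemeasurable_const
  have hset : ∀ φ, ∫ x, {x | u x < r}.indicator (fun _ => (1 : ℝ)) x * gdiv n φ x
      ∂(gaussianMeasure n) = ∫ x in {x | u x < r}, gdiv n φ x ∂(gaussianMeasure n) := by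
    intro φ
    rw [← integral_indicator₀ hA]
    refine integral_congr_ae (Eventually.of_forall fun x => ?_)
    simp [Set.indicator_apply]
  have hP : gPerimeter n {x | u x < r} =
      ENNReal.ofReal (-∫ x in {x | u x < r}, gdiv n z x ∂(gaussianMeasure n)) := by
    refine le_antisymm (iSup₂_le fun φ hφ => ENNReal.ofReal_le_ofReal ?_) ?_
    · have := setIntegral_gdiv_le hu hfin hz heq r hφ.neg
      simp only [gdiv_neg, mul_neg, integral_neg] at this
      rw [hset z] at this
      linarith
    · refine le_of_eq_of_le ?_ (le_iSup₂ (fun x => -z x) hz.neg)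
      simp only [gdiv_neg, mul_neg, integral_neg]
      rw [hset z]
  refine ⟨hP, hP.trans_le (ENNReal.ofReal_le_ofReal ?_)⟩
  calc -∫ x in {x | u x < r}, gdiv n z x ∂(gaussianMeasure n)
      ≤ |∫ x in {x | u x < r}, gdiv n z x ∂(gaussianMeasure n)| := neg_le_abs _
    _ ≤ ∫ x in {x | u x < r}, |gdiv n z x| ∂(gaussianMeasure n) := abs_integral_le_integral_abs
    _ ≤ ∫ x, |gdiv n z x| ∂(gaussianMeasure n) :=
        setIntegral_le_integral hz.integrable_gdiv.abs
          (Eventually.of_forall fun _ => abs_nonneg _)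
end
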